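/- arXiv:1902.09185 — 2 statements merged into one kernel-verified Lean document; each statement's English description precedes it below -/
import Mathlib

section
/- Let A be an artin algebra with id A ≤ 1 such that A admits a (minimal) injective coresolution whose terms all have projective dimension at most one. Then A is 1-Iwanaga–Gorenstein, i.e., id A ≤ 1 and id A^op ≤ 1. -/
open CategoryTheory TensorProduct

universe u

/-- The `k`-th Ext group of the `A`-modules `X` and `Y`. -/
noncomputable def ExtGrp (A : Type u) [Ring A] (k : ℕ)
    (X Y : Type u) [AddCommGroup X] [Module A X] [AddCommGroup Y] [Module A Y] : Type u :=
  ((Ext ℤ (ModuleCat.{u} A) k).obj (Opposite.op (ModuleCat.of A X))).obj (ModuleCat.of A Y)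

noncomputable instance (A : Type u) [Ring A] (k : ℕ)
    (X Y : Type u) [AddCommGroup X] [Module A X] [AddCommGroup Y] [Module A Y] :
    AddCommGroup (ExtGrp A k X Y) := by
  unfold ExtGrp; infer_instance

/-- `Ext_A^k(X, Y) = 0`. -/
def ExtZero (A : Type u) [Ring A] (k : ℕ)
    (X Y : Type u) [AddCommGroup X] [Module A X] [AddCommGroup Y] [Module A Y] : Prop :=
  Subsingleton (ExtGrp A k X Y)

/-- `pd X ≤ n`: `Ext^k(X, -)` vanishes for all `k > n`. -/
def ProjDimLE (A : Type u) [Ring A] (X : Type u) [AddCommGroup X] [Module A X] (n : ℕ) : Prop :=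
  ∀ k : ℕ, n < k → ∀ Y : ModuleCat.{u} A, ExtZero A k X Y

/-- The projective dimension of `X`, the length of a shortest projective resolution,
as an element of `ℕ∞` (`⊤` if infinite). -/
noncomputable def projDim (A : Type u) [Ring A] (X : Type u) [AddCommGroup X] [Module A X] : ℕ∞ :=
  sInf ((fun n : ℕ => (n : ℕ∞)) '' {n : ℕ | ProjDimLE A X n})

/-- `id Y ≤ n`: `Ext^k(-, Y)` vanishes for all `k > n`. -/
def InjDimLE (A : Type u) [Ring A] (Y : Type u) [AddCommGroup Y] [Module A Y] (n : ℕ) : Prop :=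
  ∀ k : ℕ, n < k → ∀ X : ModuleCat.{u} A, ExtZero A k X Y

/-- The injective dimension of `Y`, as an element of `ℕ∞` (`⊤` if infinite). -/
noncomputable def injDim (A : Type u) [Ring A] (Y : Type u) [AddCommGroup Y] [Module A Y] : ℕ∞ :=
  sInf ((fun n : ℕ => (n : ℕ∞)) '' {n : ℕ | InjDimLE A Y n})

/-- `X ∈ add Q`: `X` is a direct summand of a finite direct sum of copies of `Q`. -/
def InAdd (A : Type u) [Ring A] (Q : Type u) [AddCommGroup Q] [Module A Q]
    (X : Type u) [AddCommGroup X] [Module A X] : Prop :=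
  ∃ (n : ℕ) (Y : ModuleCat.{u} A), Nonempty ((X × Y) ≃ₗ[A] (Fin n → Q))

/-- `f : M → I` is an injective hull: `I` is an injective module and `f` is an essential
monomorphism. -/
def IsInjHull (A : Type u) [Ring A] {M I : Type u} [AddCommGroup M] [Module A M]
    [AddCommGroup I] [Module A I] (f : M →ₗ[A] I) : Prop :=
  Module.Injective A I ∧ Function.Injective f ∧
    ∀ N : Submodule A I, N ≠ ⊥ → N ⊓ LinearMap.range f ≠ ⊥

/-! ### Interface with Ext -/

section ExtInterface

variable (A : Type u) [Ring A]

/-- A chosen projective resolution. -/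
noncomputable def prs (X : Type u) [AddCommGroup X] [Module A X] :
    ProjectiveResolution (ModuleCat.of A X) :=
  projectiveResolution (ModuleCat.of A X)

/-- The differential, as a linear map. -/
noncomputable def prsD (X : Type u) [AddCommGroup X] [Module A X] (k : ℕ) :
    (prs A X).complex.X (k+1) →ₗ[A] (prs A X).complex.X k :=
  ((prs A X).complex.d (k+1) k).hom

/-- The augmentation. -/
noncomputable def prsE (X : Type u) [AddCommGroup X] [Module A X] :
    (prs A X).complex.X 0 →ₗ[A] X :=
  ((prs A X).π.f 0).hom

variable (X : Type u) [AddCommGroup X] [Module A X]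

instance prs_proj (k : ℕ) : Module.Projective A ((prs A X).complex.X k) := by
  have := (prs A X).projective k
  exact (IsProjective.iff_projective _).2 this

lemma prsE_surj : Function.Surjective (prsE A X) := by
  have h : Epi ((prs A X).π.f 0) := inferInstance
  exact (ModuleCat.epi_iff_surjective _).1 h

lemma prs_exact0 (x) (hx : prsE A X x = 0) : ∃ y, prsD A X 0 y = x := by
  have h := (prs A X).exact₀
  rw [ShortComplex.moduleCat_exact_iff] at h
  exact h x hx

lemma prsE_D (y) : prsE A X (prsD A X 0 y) = 0 := by
  have h := (prs A X).complex_d_comp_π_f_zero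
  exact congrArg (fun t => t.hom y) h

lemma prsD_D (k : ℕ) (y) : prsD A X k (prsD A X (k+1) y) = 0 := by
  have h := (prs A X).complex.d_comp_d (k+2) (k+1) k
  exact congrArg (fun t => t.hom y) h

lemma prs_exact (k : ℕ) (x) (hx : prsD A X k x = 0) : ∃ y, prsD A X (k+1) y = x := by
  have h := (prs A X).exact_succ k
  rw [ShortComplex.moduleCat_exact_iff] at h
  exact h x hx

lemma extZero_iff (k : ℕ) (Y : Type u) [AddCommGroup Y] [Module A Y] :
    ExtZero A (k+1) X Y ↔ ∀ g : (prs A X).complex.X (k+1) →ₗ[A] Y,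
      (∀ y, g (prsD A X (k+1) y) = 0) → ∃ h : (prs A X).complex.X k →ₗ[A] Y,
        ∀ y, h (prsD A X k y) = g y := by
  have e := (prs A X).isoExt (R := ℤ) (k+1) (ModuleCat.of A Y)
  have h1 : ExtZero A (k+1) X Y ↔
      (((prs A X).complex.linearYonedaObj ℤ (ModuleCat.of A Y)).ExactAt (k+1)) := by
    rw [HomologicalComplex.exactAt_iff_isZero_homology]
    unfold ExtZero ExtGrp
    constructor
    · intro h
      exact Limits.IsZero.of_iso (ModuleCat.isZero_of_subsingleton _) e.symm
    · intro h
      exact ModuleCat.subsingleton_of_isZero (Limits.IsZero.of_iso h e)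
  rw [h1, HomologicalComplex.exactAt_iff' _ k (k+1) (k+2) (by simp) (by simp),
    ShortComplex.moduleCat_exact_iff]
  constructor
  · intro h g hg
    obtain ⟨t, ht⟩ := h (ModuleCat.ofHom g) (by
      change (prs A X).complex.d (k+2) (k+1) ≫ ModuleCat.ofHom g = 0
      ext y
      exact hg y)
    let t' : (prs A X).complex.X k ⟶ ModuleCat.of A Y := t
    refine ⟨t'.hom, fun y => ?_⟩
    have ht' : (prs A X).complex.d (k+1) k ≫ t' = ModuleCat.ofHom g := ht
    exact congrArg (fun t => ModuleCat.Hom.hom t y) ht'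
  · intro h g hg
    let g' : (prs A X).complex.X (k+1) ⟶ ModuleCat.of A Y := g
    have hg' : (prs A X).complex.d (k+2) (k+1) ≫ g' = 0 := hg
    obtain ⟨t, ht⟩ := h g'.hom (fun y =>
      congrArg (fun t => ModuleCat.Hom.hom t y) hg')
    refine ⟨ModuleCat.ofHom t, ?_⟩
    change (prs A X).complex.d (k+1) k ≫ ModuleCat.ofHom t = g'
    ext y
    exact ht y

end ExtInterface


/-! ### Elementary homological algebra -/

section Homological

variable {A : Type u} [Ring A]

lemma projDimLE_of_projDim {X : Type u} [AddCommGroup X] [Module A X]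
    (h : projDim A X ≤ (1 : ℕ∞)) : ProjDimLE A X 1 := by
  unfold projDim at h
  by_contra hc
  have h2 : (2 : ℕ∞) ≤ sInf ((fun n : ℕ => (n : ℕ∞)) '' {n : ℕ | ProjDimLE A X n}) := by
    refine le_sInf ?_
    rintro _ ⟨n, hn, rfl⟩
    have : 2 ≤ n := by
      by_contra hlt
      exact hc (fun k hk Y => hn k (by omega) Y)
    change (2 : ℕ∞) ≤ (n : ℕ∞)
    exact_mod_cast this
  exact absurd (h2.trans h) (by decide)

lemma injDimLE_of_injDim {X : Type u} [AddCommGroup X] [Module A X]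
    (h : injDim A X ≤ (1 : ℕ∞)) : InjDimLE A X 1 := by
  unfold injDim at h
  by_contra hc
  have h2 : (2 : ℕ∞) ≤ sInf ((fun n : ℕ => (n : ℕ∞)) '' {n : ℕ | InjDimLE A X n}) := by
    refine le_sInf ?_
    rintro _ ⟨n, hn, rfl⟩
    have : 2 ≤ n := by
      by_contra hlt
      exact hc (fun k hk Y => hn k (by omega) Y)
    change (2 : ℕ∞) ≤ (n : ℕ∞)
    exact_mod_cast this
  exact absurd (h2.trans h) (by decide)

lemma injDim_of_injDimLE {X : Type u} [AddCommGroup X] [Module A X]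
    (h : InjDimLE A X 1) : injDim A X ≤ (1 : ℕ∞) :=
  sInf_le ⟨1, h, by simp⟩

/-- Schanuel's lemma. -/
lemma schanuel {P P' C : Type u} [AddCommGroup P] [Module A P] [AddCommGroup P'] [Module A P']
    [AddCommGroup C] [Module A C] [Module.Projective A P] [Module.Projective A P']
    (p : P →ₗ[A] C) (p' : P' →ₗ[A] C) (hp : Function.Surjective p)
    (hp' : Function.Surjective p') :
    Nonempty ((LinearMap.ker p × P') ≃ₗ[A] (LinearMap.ker p' × P)) := by
  obtain ⟨σ, hσ⟩ := Module.projective_lifting_property p p' hp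
  obtain ⟨τ, hτ⟩ := Module.projective_lifting_property p' p hp'
  have hσ' : ∀ x, p (σ x) = p' x := fun x => congrArg (fun t => t x) hσ
  have hτ' : ∀ x, p' (τ x) = p x := fun x => congrArg (fun t => t x) hτ
  have h1 : ∀ x : LinearMap.ker p × P', x.2 - τ (x.1 + σ x.2) ∈ LinearMap.ker p' := by
    intro x
    have := x.1.2
    rw [LinearMap.mem_ker] at this ⊢
    simp [hτ', hσ', this]
  have h2 : ∀ x : LinearMap.ker p' × P, x.2 - σ (x.1 + τ x.2) ∈ LinearMap.ker p := by
    intro x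
    have := x.1.2
    rw [LinearMap.mem_ker] at this ⊢
    simp [hτ', hσ', this]
  refine ⟨{ toFun := fun x => (⟨x.2 - τ (x.1 + σ x.2), h1 x⟩, x.1 + σ x.2)
            invFun := fun x => (⟨x.2 - σ (x.1 + τ x.2), h2 x⟩, x.1 + τ x.2)
            map_add' := ?_, map_smul' := ?_, left_inv := ?_, right_inv := ?_ }⟩
  · intro x y
    ext
    · simp; abel
    · simp; abel
  · intro a x
    ext
    · simp [smul_sub]
    · simp
  · intro x
    ext <;> simp
  · intro x
    ext <;> simp

/-- A module with a short projective resolution. -/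
def PD1 (A : Type u) [Ring A] (X : Type u) [AddCommGroup X] [Module A X] : Prop :=
  ∃ (Q : ModuleCat.{u} A) (p : Q →ₗ[A] X), Module.Projective A Q ∧ Function.Surjective p ∧
    Module.Projective A (LinearMap.ker p)

lemma pd1_of {X : Type u} [AddCommGroup X] [Module A X]
    (h : ProjDimLE A X 1) : PD1 A X := by
  refine ⟨(prs A X).complex.X 0, prsE A X, inferInstance, prsE_surj A X, ?_⟩
  have h2 := h 2 (by norm_num) (ModuleCat.of A (LinearMap.range (prsD A X 1)))
  have h2' := (extZero_iff A X 1 _).1 h2 (LinearMap.rangeRestrict (prsD A X 1))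
    (fun y => Subtype.ext (prsD_D A X 1 y))
  obtain ⟨r, hr⟩ := h2'
  -- `P₁ → ker ε` is surjective with a section `x ↦ y - r y`
  let d : (prs A X).complex.X 1 →ₗ[A] LinearMap.ker (prsE A X) :=
    (prsD A X 0).codRestrict _ (fun y => prsE_D A X y)
  have hd : Function.Surjective d := by
    rintro ⟨x, hx⟩
    obtain ⟨y, hy⟩ := prs_exact0 A X x hx
    exact ⟨y, Subtype.ext hy⟩
  let q : (prs A X).complex.X 1 →ₗ[A] (prs A X).complex.X 1 :=
    LinearMap.id - (Submodule.subtype _) ∘ₗ r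
  have hq : LinearMap.ker d ≤ LinearMap.ker q := by
    intro x hx
    have hx0 : prsD A X 0 x = 0 := congrArg Subtype.val hx
    obtain ⟨y, rfl⟩ := prs_exact A X 0 x hx0
    have := congrArg Subtype.val (hr y)
    simp only [LinearMap.mem_ker, q, LinearMap.sub_apply, LinearMap.id_apply,
      LinearMap.comp_apply, Submodule.subtype_apply]
    rw [this]; simp
  let e := d.quotKerEquivOfSurjective hd
  let s : LinearMap.ker (prsE A X) →ₗ[A] (prs A X).complex.X 1 :=
    (Submodule.liftQ _ q hq) ∘ₗ e.symm.toLinearMap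
  refine Module.Projective.of_split s d ?_
  ext1 x
  obtain ⟨y, rfl⟩ := hd x
  have : e.symm (d y) = Submodule.Quotient.mk y := by
    rw [LinearEquiv.symm_apply_eq]; rfl
  have hrz : ∀ z : LinearMap.range (prsD A X 1), d z = 0 := by
    rintro ⟨_, z, rfl⟩
    exact Subtype.ext (prsD_D A X 0 z)
  simp only [LinearMap.comp_apply, s, LinearEquiv.coe_coe, this, LinearMap.id_apply]
  change d (q y) = d y
  simp [q, hrz]

lemma PD1.prod {X Y : Type u} [AddCommGroup X] [Module A X] [AddCommGroup Y] [Module A Y]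
    (hX : PD1 A X) (hY : PD1 A Y) : PD1 A (X × Y) := by
  obtain ⟨Q, p, h1, h2, h3⟩ := hX
  obtain ⟨Q', p', h1', h2', h3'⟩ := hY
  refine ⟨ModuleCat.of A (Q × Q'), p.prodMap p', ?_, h2.prodMap h2', ?_⟩
  · change Module.Projective A (Q × Q'); infer_instance
  · let i : LinearMap.ker (p.prodMap p') →ₗ[A] LinearMap.ker p × LinearMap.ker p' :=
      LinearMap.prod
        ((LinearMap.fst A Q Q' ∘ₗ Submodule.subtype _).codRestrict _ (fun x => by
          have := x.2
          rw [LinearMap.mem_ker, LinearMap.prodMap_apply, Prod.mk_eq_zero] at this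
          exact this.1))
        ((LinearMap.snd A Q Q' ∘ₗ Submodule.subtype _).codRestrict _ (fun x => by
          have := x.2
          rw [LinearMap.mem_ker, LinearMap.prodMap_apply, Prod.mk_eq_zero] at this
          exact this.2))
    let s : LinearMap.ker p × LinearMap.ker p' →ₗ[A] LinearMap.ker (p.prodMap p') :=
      LinearMap.codRestrict _ ((Submodule.subtype _).prodMap (Submodule.subtype _)) (fun x => by
          have h1 := x.1.2
          have h2 := x.2.2
          rw [LinearMap.mem_ker] at h1 h2 ⊢
          simp [h1, h2])
    exact Module.Projective.of_split i s (by ext x <;> rfl)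

lemma inj_ext {I X Y : Type u} [AddCommGroup I] [Module A I] [AddCommGroup X] [Module A X]
    [AddCommGroup Y] [Module A Y] (hI : Module.Injective A I) (i : X →ₗ[A] Y)
    (hi : Function.Injective i) (g : X →ₗ[A] I) : ∃ h : Y →ₗ[A] I, ∀ x, h (i x) = g x :=
  hI.out i hi g

lemma inj_retract {I J : Type u} [AddCommGroup I] [Module A I] [AddCommGroup J] [Module A J]
    (hI : Module.Injective A I) (i : J →ₗ[A] I) (r : I →ₗ[A] J) (h : ∀ x, r (i x) = x) :
    Module.Injective A J :=
  ⟨fun X Y _ _ _ _ j hj g => by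
    obtain ⟨k, hk⟩ := hI.out j hj (i ∘ₗ g)
    exact ⟨r ∘ₗ k, fun x => by simp [hk, h]⟩⟩

lemma inj_prod {I J : Type u} [AddCommGroup I] [Module A I] [AddCommGroup J] [Module A J]
    (hI : Module.Injective A I) (hJ : Module.Injective A J) : Module.Injective A (I × J) :=
  ⟨fun X Y _ _ _ _ j hj g => by
    obtain ⟨k, hk⟩ := hI.out j hj (LinearMap.fst A I J ∘ₗ g)
    obtain ⟨l, hl⟩ := hJ.out j hj (LinearMap.snd A I J ∘ₗ g)
    exact ⟨k.prod l, fun x => by ext <;> simp [hk, hl]⟩⟩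

/-- Descend a linear map along a surjection. -/
lemma descend {P B Y : Type u} [AddCommGroup P] [Module A P] [AddCommGroup B] [Module A B]
    [AddCommGroup Y] [Module A Y] (d : P →ₗ[A] B) (hd : Function.Surjective d)
    (q : P →ₗ[A] Y) (hq : ∀ x, d x = 0 → q x = 0) : ∃ h : B →ₗ[A] Y, ∀ x, h (d x) = q x := by
  let e := d.quotKerEquivOfSurjective hd
  refine ⟨(Submodule.liftQ (LinearMap.ker d) q (fun x hx => hq x hx)) ∘ₗ e.symm.toLinearMap, ?_⟩
  intro x
  have : e.symm (d x) = Submodule.Quotient.mk x := by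
    rw [LinearEquiv.symm_apply_eq]; rfl
  simp only [LinearMap.comp_apply, LinearEquiv.coe_coe, this]
  rfl

/-- Corestrict along an injection. -/
lemma corestr {P B Y : Type u} [AddCommGroup P] [Module A P] [AddCommGroup B] [Module A B]
    [AddCommGroup Y] [Module A Y] (f : Y →ₗ[A] B) (hf : Function.Injective f)
    (q : P →ₗ[A] B) (hq : ∀ x, ∃ y, f y = q x) : ∃ h : P →ₗ[A] Y, ∀ x, f (h x) = q x := by
  let e := LinearEquiv.ofInjective f hf
  refine ⟨e.symm.toLinearMap ∘ₗ q.codRestrict (LinearMap.range f) hq, fun x => ?_⟩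
  have := congrArg Subtype.val (e.apply_symm_apply (q.codRestrict (LinearMap.range f) hq x))
  exact this

lemma inj_quot {Y I : Type u} [AddCommGroup Y] [Module A Y] [AddCommGroup I] [Module A I]
    (hY : InjDimLE A Y 1) (hI : Module.Injective A I) (f : Y →ₗ[A] I)
    (hf : Function.Injective f) : Module.Injective A (I ⧸ LinearMap.range f) := by
  refine Module.Baer.injective ?_
  intro 𝔞 h
  let X := A ⧸ 𝔞
  have hext := (extZero_iff A X 1 Y).1 (hY 2 (by norm_num) (ModuleCat.of A X))
  let P1 := (prs A X).complex.X 1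
  let P0 := (prs A X).complex.X 0
  -- compare `P₀ → X` with `A → X`
  obtain ⟨π, hπ⟩ := Module.projective_lifting_property (Submodule.mkQ 𝔞) (prsE A X)
    (Submodule.mkQ_surjective _)
  obtain ⟨g, hg⟩ := Module.projective_lifting_property (prsE A X) (Submodule.mkQ 𝔞)
    (prsE_surj A X)
  have hπ' : ∀ x, Submodule.mkQ 𝔞 (π x) = prsE A X x := fun x => congrArg (fun t => t x) hπ
  have hg' : ∀ x, prsE A X (g x) = Submodule.mkQ 𝔞 x := fun x => congrArg (fun t => t x) hg
  have hmem : ∀ x : A, Submodule.mkQ 𝔞 x = 0 → x ∈ 𝔞 := fun x hx => by simpa using hx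
  let m : P1 →ₗ[A] 𝔞 := (π ∘ₗ prsD A X 0).codRestrict 𝔞 (fun x => hmem _ (by
    rw [LinearMap.comp_apply, hπ', prsE_D]))
  obtain ⟨l, hl⟩ := Module.projective_lifting_property (Submodule.mkQ (LinearMap.range f))
    (h ∘ₗ m) (Submodule.mkQ_surjective _)
  have hl' : ∀ x, Submodule.mkQ (LinearMap.range f) (l x) = h (m x) :=
    fun x => congrArg (fun t => t x) hl
  have hm : ∀ y, m (prsD A X 1 y) = 0 := fun y => Subtype.ext (by
    change π (prsD A X 0 (prsD A X 1 y)) = 0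
    rw [prsD_D, map_zero])
  obtain ⟨c, hc⟩ := corestr f hf (l ∘ₗ prsD A X 1) (fun y => by
    have := hl' (prsD A X 1 y)
    rw [hm, map_zero] at this
    simpa using this)
  obtain ⟨b, hb⟩ := hext c (fun y => hf (by
    rw [hc, LinearMap.comp_apply, prsD_D, map_zero, map_zero]))
  -- `l - f b` kills the kernel of `P₁ → P₀`
  obtain ⟨t, ht⟩ := descend (P := P1) (LinearMap.rangeRestrict (prsD A X 0))
    (LinearMap.surjective_rangeRestrict _) (l - f ∘ₗ b) (fun x hx => by
      obtain ⟨y, rfl⟩ := prs_exact A X 0 x (congrArg Subtype.val hx)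
      simp only [LinearMap.sub_apply, LinearMap.comp_apply, hb]
      rw [hc]; simp)
  obtain ⟨T, hT⟩ := inj_ext hI (Submodule.subtype (LinearMap.range (prsD A X 0)))
    Subtype.val_injective t
  have hga : ∀ a : A, a - π (g a) ∈ 𝔞 := fun a => hmem _ (by
    rw [map_sub, hπ', hg', sub_self])
  let u : A →ₗ[A] 𝔞 := (LinearMap.id - π ∘ₗ g).codRestrict 𝔞 hga
  refine ⟨(Submodule.mkQ (LinearMap.range f)) ∘ₗ T ∘ₗ g + h ∘ₗ u, ?_⟩
  intro x hx
  obtain ⟨y, hy⟩ := prs_exact0 A X (g x) (by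
    rw [hg']; exact (Submodule.Quotient.mk_eq_zero _).2 hx)
  have e1 : T (g x) = l y - f (b y) := by
    rw [← hy]
    exact (hT ⟨prsD A X 0 y, y, rfl⟩).trans (ht y)
  simp only [LinearMap.add_apply, LinearMap.comp_apply, e1, map_sub, hl']
  have e2 : Submodule.mkQ (LinearMap.range f) (f (b y)) = 0 := by simp
  rw [e2, sub_zero, ← map_add]
  congr 1
  apply Subtype.ext
  change π (prsD A X 0 y) + (x - π (g x)) = x
  rw [hy]; abel

lemma injDimLE_of {Y I : Type u} [AddCommGroup Y] [Module A Y] [AddCommGroup I] [Module A I]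
    (hI : Module.Injective A I) (f : Y →ₗ[A] I)
    (hf : Function.Injective f) (hC : Module.Injective A (I ⧸ LinearMap.range f)) :
    InjDimLE A Y 1 := by
  intro k hk X
  obtain ⟨n, rfl⟩ : ∃ n, k = n + 1 + 1 := ⟨k - 2, by omega⟩
  rw [extZero_iff]
  intro g hg
  obtain ⟨t, ht⟩ := descend (LinearMap.rangeRestrict (prsD A X (n+1)))
    (LinearMap.surjective_rangeRestrict _) (f ∘ₗ g) (fun x hx => by
      obtain ⟨y, rfl⟩ := prs_exact A X (n+1) x (congrArg Subtype.val hx)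
      simp [hg])
  obtain ⟨T, hT⟩ := inj_ext hI (Submodule.subtype (LinearMap.range (prsD A X (n+1))))
    Subtype.val_injective t
  have hT' : ∀ y, T (prsD A X (n+1) y) = f (g y) := fun y =>
    (hT ⟨_, y, rfl⟩).trans (ht y)
  let q := Submodule.mkQ (LinearMap.range f)
  have hq : ∀ y, q (f y) = 0 := fun y => by simp [q]
  obtain ⟨s, hs⟩ := descend (LinearMap.rangeRestrict (prsD A X n))
    (LinearMap.surjective_rangeRestrict _) (q ∘ₗ T) (fun x hx => by
      obtain ⟨y, rfl⟩ := prs_exact A X n x (congrArg Subtype.val hx)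
      rw [LinearMap.comp_apply, hT', hq])
  obtain ⟨S, hS⟩ := inj_ext hC (Submodule.subtype (LinearMap.range (prsD A X n)))
    Subtype.val_injective s
  obtain ⟨L, hL⟩ := Module.projective_lifting_property q S (Submodule.mkQ_surjective _)
  have hL' : ∀ x, q (L x) = S x := fun x => congrArg (fun t => t x) hL
  have hS' : ∀ y, S (prsD A X n y) = q (T y) := fun y => (hS ⟨_, y, rfl⟩).trans (hs y)
  obtain ⟨h, hh⟩ := corestr f hf (T - L ∘ₗ prsD A X n) (fun x => by
    have : q (T x - L (prsD A X n x)) = 0 := by rw [map_sub, hL', hS', sub_self]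
    exact (Submodule.Quotient.mk_eq_zero _).1 this)
  refine ⟨h, fun y => hf ?_⟩
  rw [hh, LinearMap.sub_apply, hT', LinearMap.comp_apply, prsD_D, map_zero, sub_zero]

end Homological


/-! ### From a cogenerator of projective dimension at most one to the other side -/

section Other

variable {A : Type u} [Ring A]

lemma exact_proj {F G P : Type} [Fintype F] [Fintype G] (a : F → P → A) (m : G → F → A)
    (hex : ∀ x : F → A, (∀ t, ∑ j, a j t * x j = 0) → ∃ z : G → A, ∀ j, x j = ∑ i, m i j * z i)
    (Q : Type u) [AddCommGroup Q] [Module A Q] [hQ : Module.Projective A Q]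
    (x : F → Q) (hx : ∀ t, ∑ j, a j t • x j = 0) :
    ∃ z : G → Q, ∀ j, x j = ∑ i, m i j • z i := by
  classical
  obtain ⟨s, hs⟩ := Module.projective_def'.1 hQ
  have hs' : ∀ q, Finsupp.linearCombination A id (s q) = q := fun q =>
    congrArg (fun t => t q) hs
  have h1 : ∀ c : Q, ∃ z : G → A, ∀ j, s (x j) c = ∑ i, m i j * z i := by
    intro c
    refine hex _ (fun t => ?_)
    have := congrArg (fun r => s r c) (hx t)
    simpa [map_sum, Finsupp.finset_sum_apply] using this
  choose z hz using h1
  let S : Finset Q := Finset.univ.biUnion (fun j => (s (x j)).support)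
  refine ⟨fun i => ∑ c ∈ S, z c i • c, fun j => ?_⟩
  calc x j = Finsupp.linearCombination A id (s (x j)) := (hs' _).symm
    _ = ∑ c ∈ S, (s (x j) c) • c := by
        rw [Finsupp.linearCombination_apply, Finsupp.sum]
        refine Finset.sum_subset ?_ ?_
        · intro c hc
          exact Finset.mem_biUnion.2 ⟨j, Finset.mem_univ _, hc⟩
        · intro c _ hc
          rw [Finsupp.notMem_support_iff] at hc
          simp [hc]
    _ = ∑ c ∈ S, ∑ i, m i j • z c i • c := by
        refine Finset.sum_congr rfl (fun c _ => ?_)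
        rw [hz, Finset.sum_smul]
        simp [mul_smul]
    _ = _ := by
        rw [Finset.sum_comm]
        simp [Finset.smul_sum]

lemma exact_pd1 {F G H P : Type} [Fintype F] [Fintype G] [Fintype H]
    (a : F → P → A) (m : G → F → A) (n : H → G → A)
    (hex : ∀ x : F → A, (∀ t, ∑ j, a j t * x j = 0) → ∃ z : G → A, ∀ j, x j = ∑ i, m i j * z i)
    (hex2 : ∀ x : G → A, (∀ t, ∑ j, m j t * x j = 0) → ∃ z : H → A, ∀ j, x j = ∑ i, n i j * z i)
    (hc : ∀ i t, ∑ j, a j t * m i j = 0)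
    (J : Type u) [AddCommGroup J] [Module A J] (hJ : PD1 A J)
    (y : G → J) (hy : ∀ j, ∑ i, m i j • y i = 0) :
    ∃ w : H → J, ∀ i, y i = ∑ l, n l i • w l := by
  obtain ⟨Q, p, hQ, hp, hK⟩ := hJ
  choose y0 hy0 using fun i => hp (y i)
  have hv : ∀ j, ∑ i, m i j • y0 i ∈ LinearMap.ker p := fun j => by
    rw [LinearMap.mem_ker, map_sum]
    simpa [hy0] using hy j
  obtain ⟨z, hz⟩ := exact_proj a m hex (LinearMap.ker p) (fun j => ⟨_, hv j⟩) (fun t => by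
    apply Subtype.ext
    simp only [Submodule.coe_sum, Submodule.coe_smul, Finset.smul_sum, Submodule.coe_zero]
    rw [Finset.sum_comm]
    refine Finset.sum_eq_zero (fun i _ => ?_)
    have := congrArg (fun r => r • y0 i) (hc i t)
    simpa [Finset.sum_smul, mul_smul] using this)
  have hz' : ∀ j, ∑ i, m i j • y0 i = ∑ i, m i j • (z i : Q) := fun j => by
    have := congrArg Subtype.val (hz j)
    simpa using this
  obtain ⟨w, hw⟩ := exact_proj m n hex2 Q (fun i => y0 i - z i) (fun t => by
    simp [smul_sub, Finset.sum_sub_distrib, hz'])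
  refine ⟨fun l => p (w l), fun i => ?_⟩
  have h1 := congrArg p (hw i)
  have h2 : p (z i) = 0 := (z i).2
  simpa [hy0, h2] using h1

lemma cogen_of_simple (J : Type u) [AddCommGroup J] [Module A J] (hJ : Module.Injective A J)
    (hS : ∀ 𝔪 : Ideal A, 𝔪.IsMaximal → ∃ φ : (A ⧸ 𝔪) →ₗ[A] J, φ ≠ 0)
    (M : Type u) [AddCommGroup M] [Module A M] (L : Submodule A M) (v : M) (hv : v ∉ L) :
    ∃ φ : M →ₗ[A] J, (∀ x ∈ L, φ x = 0) ∧ φ v ≠ 0 := by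
  -- the annihilator of `v` in `M ⧸ L`
  let w : M ⧸ L := L.mkQ v
  have hw : w ≠ 0 := fun h => hv ((Submodule.Quotient.mk_eq_zero _).1 h)
  let τ : A →ₗ[A] M ⧸ L := LinearMap.toSpanSingleton A _ w
  have hne : LinearMap.ker τ ≠ ⊤ := by
    intro h
    apply hw
    have : (1 : A) ∈ LinearMap.ker τ := h ▸ Submodule.mem_top
    simpa [τ] using this
  obtain ⟨𝔪, hm, hle⟩ := Ideal.exists_le_maximal (LinearMap.ker τ) hne
  obtain ⟨φ, hφ⟩ := hS 𝔪 hm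
  have hφ1 : φ (Submodule.mkQ 𝔪 1) ≠ 0 := by
    intro h
    apply hφ
    ext
    simpa using h
  obtain ⟨t, ht⟩ := descend (LinearMap.rangeRestrict τ) (LinearMap.surjective_rangeRestrict _)
    (φ ∘ₗ Submodule.mkQ 𝔪) (fun x hx => by
      have hx' : x ∈ 𝔪 := hle (congrArg Subtype.val hx)
      rw [LinearMap.comp_apply, Submodule.mkQ_apply, (Submodule.Quotient.mk_eq_zero _).2 hx',
        map_zero])
  obtain ⟨T, hT⟩ := inj_ext hJ (Submodule.subtype (LinearMap.range τ)) Subtype.val_injective t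
  refine ⟨T ∘ₗ L.mkQ, fun x hx => ?_, ?_⟩
  · rw [LinearMap.comp_apply, Submodule.mkQ_apply, (Submodule.Quotient.mk_eq_zero _).2 hx,
      map_zero]
  · have : T (L.mkQ v) = φ (Submodule.mkQ 𝔪 1) := by
      have e : L.mkQ v = τ 1 := by simp [τ, w]
      rw [e]
      exact (hT ⟨τ 1, 1, rfl⟩).trans (ht 1)
    rw [LinearMap.comp_apply, this]
    exact hφ1

lemma dual_exact {F G H : Type} [Fintype F] [Fintype G] [Fintype H]
    (m : G → F → A) (n : H → G → A)
    (J : Type u) [AddCommGroup J] [Module A J]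
    (hcog : ∀ (L : Submodule A (G → A)) (v : G → A), v ∉ L →
      ∃ φ : (G → A) →ₗ[A] J, (∀ x ∈ L, φ x = 0) ∧ φ v ≠ 0)
    (hJ : ∀ y : G → J, (∀ j, ∑ i, m i j • y i = 0) → ∃ w : H → J, ∀ i, y i = ∑ l, n l i • w l)
    (v : G → A) (hv : ∀ l, ∑ i, v i * n l i = 0) :
    ∃ u : F → A, ∀ i, v i = ∑ j, u j * m i j := by
  classical
  let L : Submodule A (G → A) := Submodule.span A (Set.range fun j : F => fun i => m i j)
  by_cases hL : v ∈ L
  · obtain ⟨c, hc⟩ := (Submodule.mem_span_range_iff_exists_fun A).1 hL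
    refine ⟨c, fun i => ?_⟩
    rw [← hc]
    simp
  · exfalso
    obtain ⟨φ, h1, h2⟩ := hcog L v hL
    apply h2
    have hφ : ∀ x : G → A, φ x = ∑ i, x i • φ (Pi.single i 1) := by
      intro x
      conv_lhs => rw [← Finset.univ_sum_single x]
      rw [map_sum]
      refine Finset.sum_congr rfl (fun i _ => ?_)
      rw [← map_smul, ← Pi.single_smul, smul_eq_mul, mul_one]
    obtain ⟨w, hw⟩ := hJ (fun i => φ (Pi.single i 1)) (fun j => by
      rw [← hφ (fun i => m i j)]
      exact h1 _ (Submodule.subset_span ⟨j, rfl⟩))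
    rw [hφ]
    simp only [hw, Finset.smul_sum]
    rw [Finset.sum_comm]
    refine Finset.sum_eq_zero (fun l _ => ?_)
    have := congrArg (fun r => r • w l) (hv l)
    simpa [Finset.sum_smul, mul_smul] using this

lemma exists_gens (R : Type u) [Ring R] [IsNoetherianRing R] {M : Type u} [AddCommGroup M]
    [Module R M] [IsNoetherian R M] (N : Submodule R M) :
    ∃ (g : ℕ) (m : Fin g → M), N = Submodule.span R (Set.range m) := by
  obtain ⟨g, m, h⟩ := Submodule.fg_iff_exists_fin_generating_family.1 (IsNoetherian.noetherian N)
  exact ⟨g, m, h.symm⟩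

open MulOpposite in
theorem injDimLE_op [IsNoetherianRing Aᵐᵒᵖ]
    (J : Type u) [AddCommGroup J] [Module A J] (hJinj : Module.Injective A J)
    (hS : ∀ 𝔪 : Ideal A, 𝔪.IsMaximal → ∃ φ : (A ⧸ 𝔪) →ₗ[A] J, φ ≠ 0)
    (hJ : PD1 A J) : InjDimLE Aᵐᵒᵖ Aᵐᵒᵖ 1 := by
  classical
  obtain ⟨⟨H, hH, f, hf⟩⟩ := EnoughInjectives.presentation (ModuleCat.of Aᵐᵒᵖ Aᵐᵒᵖ)
  have hHi : Module.Injective Aᵐᵒᵖ H := Module.injective_module_of_injective_object _ _ (inj := hH)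
  have hfi : Function.Injective f.hom := (ModuleCat.mono_iff_injective f).1 hf
  let f' : Aᵐᵒᵖ →ₗ[Aᵐᵒᵖ] H := f.hom
  refine injDimLE_of hHi f' hfi ?_
  refine Module.Baer.injective ?_
  intro 𝔞 h
  obtain ⟨k, a, ha⟩ := exists_gens Aᵐᵒᵖ 𝔞
  have hamem : ∀ j, a j ∈ 𝔞 := fun j => ha ▸ Submodule.subset_span ⟨j, rfl⟩
  let α : (Fin k → Aᵐᵒᵖ) →ₗ[Aᵐᵒᵖ] Aᵐᵒᵖ := Fintype.linearCombination Aᵐᵒᵖ a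
  obtain ⟨g, m, hm⟩ := exists_gens Aᵐᵒᵖ (LinearMap.ker α)
  have hmmem : ∀ j, m j ∈ LinearMap.ker α := fun j => hm ▸ Submodule.subset_span ⟨j, rfl⟩
  let μ : (Fin g → Aᵐᵒᵖ) →ₗ[Aᵐᵒᵖ] (Fin k → Aᵐᵒᵖ) := Fintype.linearCombination Aᵐᵒᵖ m
  obtain ⟨q, n, hn⟩ := exists_gens Aᵐᵒᵖ (LinearMap.ker μ)
  have hnmem : ∀ j, n j ∈ LinearMap.ker μ := fun j => hn ▸ Submodule.subset_span ⟨j, rfl⟩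
  have hα : ∀ x, α x = ∑ j, x j * a j := fun x => by
    simp [α, Fintype.linearCombination_apply]
  have hμ : ∀ x j, μ x j = ∑ i, x i * m i j := fun x j => by
    simp [μ, Fintype.linearCombination_apply]
  -- unopped data
  have hex : ∀ x : Fin k → A, (∀ t : Unit, ∑ j, (a j).unop * x j = 0) →
      ∃ z : Fin g → A, ∀ j, x j = ∑ i, (m i j).unop * z i := by
    intro x hx
    have : (fun j => op (x j)) ∈ LinearMap.ker α := by
      rw [LinearMap.mem_ker, hα]
      apply unop_injective
      simpa [unop_sum] using hx ()
    rw [hm] at this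
    obtain ⟨c, hc⟩ := (Submodule.mem_span_range_iff_exists_fun _).1 this
    refine ⟨fun i => (c i).unop, fun j => ?_⟩
    have := congrArg unop (congrFun hc j)
    simpa [unop_sum] using this.symm
  have hex2 : ∀ x : Fin g → A, (∀ t, ∑ j, (m j t).unop * x j = 0) →
      ∃ z : Fin q → A, ∀ j, x j = ∑ i, (n i j).unop * z i := by
    intro x hx
    have : (fun j => op (x j)) ∈ LinearMap.ker μ := by
      rw [LinearMap.mem_ker]
      funext t
      rw [hμ]
      apply unop_injective
      simpa [unop_sum] using hx t
    rw [hn] at this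
    obtain ⟨c, hc⟩ := (Submodule.mem_span_range_iff_exists_fun _).1 this
    refine ⟨fun i => (c i).unop, fun j => ?_⟩
    have := congrArg unop (congrFun hc j)
    simpa [unop_sum] using this.symm
  have hc : ∀ i (t : Unit), ∑ j, (a j).unop * (m i j).unop = 0 := by
    intro i _
    have := hmmem i
    rw [LinearMap.mem_ker, hα] at this
    simpa [unop_sum] using congrArg unop this
  have hdual := dual_exact (fun i j => (m i j).unop) (fun l i => (n l i).unop) J
    (fun L v hv => cogen_of_simple J hJinj hS _ L v hv)
    (exact_pd1 (fun j (_ : Unit) => (a j).unop) (fun i j => (m i j).unop)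
      (fun l i => (n l i).unop) hex hex2 hc J hJ)
  -- lift the generators
  let Q := Submodule.mkQ (LinearMap.range f')
  have hQf : ∀ x, Q (f' x) = 0 := fun x => (Submodule.Quotient.mk_eq_zero _).2 ⟨x, rfl⟩
  choose t ht using fun j => Submodule.mkQ_surjective (LinearMap.range f') (h ⟨a j, hamem j⟩)
  have hαmem : ∀ x, α x ∈ 𝔞 := fun x => by
    rw [hα]
    exact Submodule.sum_mem _ (fun j _ => 𝔞.smul_mem _ (hamem j))
  let α' : (Fin k → Aᵐᵒᵖ) →ₗ[Aᵐᵒᵖ] 𝔞 := α.codRestrict 𝔞 hαmem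
  have hα' : Function.Surjective α' := by
    rintro ⟨x, hx⟩
    rw [ha] at hx
    obtain ⟨c, hc⟩ := (Submodule.mem_span_range_iff_exists_fun _).1 hx
    refine ⟨c, Subtype.ext ?_⟩
    change α c = x
    rw [hα, ← hc]; simp
  let T : (Fin k → Aᵐᵒᵖ) →ₗ[Aᵐᵒᵖ] H := Fintype.linearCombination Aᵐᵒᵖ t
  have hT : ∀ x, Q (T x) = h (α' x) := by
    intro x
    have e : α' x = ∑ j, x j • (⟨a j, hamem j⟩ : 𝔞) := by
      apply Subtype.ext
      change α x = _
      rw [hα]; simp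
    rw [e]
    simp only [T, Fintype.linearCombination_apply, map_sum, map_smul]
    exact Finset.sum_congr rfl (fun j _ => congrArg _ (ht j))
  obtain ⟨c, hcc⟩ := corestr f' hfi (T ∘ₗ μ) (fun z => by
    have h0 : α' (μ z) = 0 := by
      apply Subtype.ext
      change α (μ z) = 0
      have : μ z ∈ LinearMap.ker α := by
        simp only [μ, Fintype.linearCombination_apply]
        exact Submodule.sum_mem _ (fun j _ => Submodule.smul_mem _ _ (hmmem j))
      exact this
    have : Q (T (μ z)) = 0 := by rw [hT, h0, map_zero]
    exact (Submodule.Quotient.mk_eq_zero _).1 this)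
  have hcsum : ∀ x, c x = ∑ i, x i * c (Pi.single i 1) := by
    intro x
    conv_lhs => rw [← Finset.univ_sum_single x]
    rw [map_sum]
    refine Finset.sum_congr rfl (fun i _ => ?_)
    rw [← smul_eq_mul, ← map_smul, ← Pi.single_smul, smul_eq_mul, mul_one]
  obtain ⟨u, hu⟩ := hdual (fun i => (c (Pi.single i 1)).unop) (fun l => by
    have h0 : c (n l) = 0 := hfi (by
      change f' (c (n l)) = f' 0
      rw [hcc, LinearMap.comp_apply]
      have : μ (n l) = 0 := hnmem l
      rw [this, map_zero, map_zero])
    rw [hcsum] at h0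
    simpa [unop_sum] using congrArg unop h0)
  let U : (Fin k → Aᵐᵒᵖ) →ₗ[Aᵐᵒᵖ] Aᵐᵒᵖ := Fintype.linearCombination Aᵐᵒᵖ (fun j => op (u j))
  have hU : ∀ i, U (m i) = c (Pi.single i 1) := by
    intro i
    apply unop_injective
    rw [hu]
    simp [U, Fintype.linearCombination_apply, unop_sum]
  have hmT : ∀ i, T (m i) = f' (c (Pi.single i 1)) := by
    intro i
    rw [hcc, LinearMap.comp_apply]
    congr 1
    simp [μ]
  obtain ⟨r, hr⟩ := descend α' hα' (T - f' ∘ₗ U) (fun x hx => by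
    have hx' : x ∈ LinearMap.ker α := congrArg Subtype.val hx
    rw [hm] at hx'
    have hle : Submodule.span Aᵐᵒᵖ (Set.range m) ≤ LinearMap.ker (T - f' ∘ₗ U) := by
      rw [Submodule.span_le]
      rintro _ ⟨i, rfl⟩
      change (T - f' ∘ₗ U) (m i) = 0
      rw [LinearMap.sub_apply, LinearMap.comp_apply, hU, hmT, sub_self]
    exact hle hx')
  obtain ⟨W, hW⟩ := inj_ext hHi (Submodule.subtype 𝔞) Subtype.val_injective r
  refine ⟨Q ∘ₗ W, fun x hx => ?_⟩
  obtain ⟨z, hz⟩ := hα' ⟨x, hx⟩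
  rw [← hz, ← hT, LinearMap.comp_apply]
  have e1 : W x = r ⟨x, hx⟩ := hW ⟨x, hx⟩
  rw [e1, ← hz, hr, LinearMap.sub_apply, map_sub, LinearMap.comp_apply, hQf, sub_zero]

end Other



section counting
set_option linter.unusedSectionVars false

variable (R : Type u) [CommRing R] [IsArtinianRing R] (A : Type u) [Ring A] [Algebra R A]

lemma finHom (P X : Type u) [AddCommGroup P] [Module A P] [Module.Finite A P]
    [AddCommGroup X] [Module A X] [Module R X] [IsScalarTower R A X] [Module.Finite R X] :
    Module.Finite R (P →ₗ[A] X) := by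
  obtain ⟨n, s, hs⟩ := Module.Finite.exists_fin (R := A) (M := P)
  let φ : (P →ₗ[A] X) →ₗ[R] (Fin n → X) :=
    { toFun := fun g i => g (s i)
      map_add' := fun _ _ => rfl
      map_smul' := fun _ _ => rfl }
  refine Module.Finite.of_injective φ ?_
  intro g g' h
  refine LinearMap.ext_on_range (v := s) hs fun i => congrFun h i

/-- length of the Hom space over the base ring -/
noncomputable def hh (X Y : Type u) [AddCommGroup X] [Module A X]
    [AddCommGroup Y] [Module A Y] [Module R Y] [IsScalarTower R A Y] : ℕ :=
  (Module.length R (X →ₗ[A] Y)).toNat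

section
variable {X X' Y Y' : Type u} [AddCommGroup X] [Module A X] [AddCommGroup X'] [Module A X']
    [AddCommGroup Y] [Module A Y] [Module R Y] [IsScalarTower R A Y]
    [AddCommGroup Y'] [Module A Y'] [Module R Y'] [IsScalarTower R A Y']

lemma hh_left (e : X ≃ₗ[A] X') : hh R A X Y = hh R A X' Y := by
  unfold hh
  congr 1
  refine LinearEquiv.length_eq (R := R)
    { toFun := fun g => g ∘ₗ e.symm.toLinearMap
      invFun := fun g => g ∘ₗ e.toLinearMap
      map_add' := fun _ _ => rfl
      map_smul' := fun _ _ => rfl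
      left_inv := fun g => by ext x; simp
      right_inv := fun g => by ext x; simp }

lemma lin_smul (e : Y →ₗ[A] Y') (r : R) (y : Y) : e (r • y) = r • e y := by
  rw [← algebraMap_smul A r y, map_smul, algebraMap_smul]

lemma hh_right (e : Y ≃ₗ[A] Y') : hh R A X Y = hh R A X Y' := by
  unfold hh
  congr 1
  refine LinearEquiv.length_eq (R := R)
    { toFun := fun g => e.toLinearMap ∘ₗ g
      invFun := fun g => e.symm.toLinearMap ∘ₗ g
      map_add' := fun g g' => by ext x; simp
      map_smul' := fun r g => by ext x; exact lin_smul R A e.toLinearMap r (g x)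
      left_inv := fun g => by ext x; simp
      right_inv := fun g => by ext x; simp }

lemma hlen [Module.Finite A X] [Module.Finite R Y] : Module.length R (X →ₗ[A] Y) ≠ ⊤ := by
  have := finHom R A X Y
  exact Module.length_ne_top

lemma hh_coe [Module.Finite A X] [Module.Finite R Y] :
    ((hh R A X Y : ℕ) : ℕ∞) = Module.length R (X →ₗ[A] Y) :=
  ENat.natCast_toNat (hlen R A)

lemma hh_zero_iff [Module.Finite A X] [Module.Finite R Y] :
    hh R A X Y = 0 ↔ ∀ g : X →ₗ[A] Y, g = 0 := by
  rw [← Nat.cast_inj (R := ℕ∞), hh_coe, Nat.cast_zero, Module.length_eq_zero_iff]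
  constructor
  · intro h g; exact Subsingleton.elim _ _
  · intro h; exact ⟨fun a b => by rw [h a, h b]⟩

lemma hh_prod_left [Module.Finite A X] [Module.Finite A X'] [Module.Finite R Y] :
    hh R A (X × X') Y = hh R A X Y + hh R A X' Y := by
  rw [← Nat.cast_inj (R := ℕ∞), Nat.cast_add, hh_coe, hh_coe, hh_coe, ← Module.length_prod]
  exact (LinearMap.coprodEquiv (R := A) R (M := X) (M₂ := X') (M₃ := Y)).symm.length_eq

lemma hh_prod_right [Module.Finite A X] [Module.Finite R Y] [Module.Finite R Y'] :
    hh R A X (Y × Y') = hh R A X Y + hh R A X Y' := by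
  rw [← Nat.cast_inj (R := ℕ∞), Nat.cast_add, hh_coe, hh_coe, hh_coe, ← Module.length_prod]
  exact (LinearMap.prodEquiv (R := A) R (M := X) (M₂ := Y) (M₃ := Y')).symm.length_eq

lemma hh_pi_left {κ : Type} [Fintype κ] [DecidableEq κ] (Z : κ → Type u)
    [∀ i, AddCommGroup (Z i)] [∀ i, Module A (Z i)] [∀ i, Module.Finite A (Z i)]
    [Module.Finite R Y] :
    hh R A (∀ i, Z i) Y = ∑ i, hh R A (Z i) Y := by
  rw [← Nat.cast_inj (R := ℕ∞), Nat.cast_sum, hh_coe]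
  simp_rw [hh_coe]
  rw [← Module.length_pi_of_fintype]
  exact (LinearMap.lsum A Z R (M := Y)).symm.length_eq

lemma hh_pi_right {κ : Type} [Fintype κ] [DecidableEq κ] (Z : κ → Type u)
    [∀ i, AddCommGroup (Z i)] [∀ i, Module A (Z i)] [∀ i, Module R (Z i)]
    [∀ i, IsScalarTower R A (Z i)] [∀ i, Module.Finite R (Z i)]
    [Module.Finite A X] :
    hh R A X (∀ i, Z i) = ∑ i, hh R A X (Z i) := by
  rw [← Nat.cast_inj (R := ℕ∞), Nat.cast_sum, hh_coe]
  simp_rw [hh_coe]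
  rw [← Module.length_pi_of_fintype]
  refine LinearEquiv.length_eq (R := R)
    { toFun := fun g i => LinearMap.proj i ∘ₗ g
      invFun := fun g => LinearMap.pi g
      map_add' := fun g g' => rfl
      map_smul' := fun r g => rfl
      left_inv := fun g => rfl
      right_inv := fun g => rfl }

end

section
variable [Module.Finite R A]

lemma finSub {M : Type u} [AddCommGroup M] [Module A M] [Module R M]
    [IsScalarTower R A M] [Module.Finite R M] (N : Submodule A M) : Module.Finite R N :=
  Module.Finite.of_injective (N.subtype.restrictScalars R) (Submodule.subtype_injective _)

lemma embed_ss (n : ℕ) : ∀ (M N : Type u) [AddCommGroup M] [Module A M] [Module R M]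
    [IsScalarTower R A M] [Module.Finite R M] [AddCommGroup N] [Module A N] [Module R N]
    [IsScalarTower R A N] [Module.Finite R N] [IsSemisimpleModule A M] [IsSemisimpleModule A N],
    Module.length R M ≤ n →
    (∀ (S : Type u) [AddCommGroup S] [Module A S] [Module.Finite A S] [IsSimpleModule A S],
      hh R A S M ≤ hh R A S N) → ∃ g : M →ₗ[A] N, Function.Injective g := by
  induction n with
  | zero =>
    intro M N _ _ _ _ _ _ _ _ _ _ _ _ hl _
    have : Subsingleton M := Module.length_eq_zero_iff.1 (by simpa using hl)
    exact ⟨0, fun a b _ => Subsingleton.elim a b⟩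
  | succ n ih =>
    intro M N _ _ _ _ _ _ _ _ _ _ _ _ hl hS
    rcases subsingleton_or_nontrivial M with hM | hM
    · exact ⟨0, fun a b _ => Subsingleton.elim a b⟩
    obtain ⟨m, hm⟩ := IsSemisimpleModule.exists_simple_submodule A M
    obtain ⟨q, hq⟩ := exists_isCompl m
    have e := Submodule.prodEquivOfIsCompl m q hq
    have key : ¬ hh R A m N = 0 := by
      intro h0
      have h1 : hh R A m M = 0 := by have := hS m; omega
      rw [hh_zero_iff] at h1
      have h2 := h1 m.subtype
      have := IsSimpleModule.nontrivial A m
      obtain ⟨x, hx⟩ := exists_ne (0 : m)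
      exact hx (Subtype.ext (by simpa using LinearMap.congr_fun h2 x))
    rw [hh_zero_iff] at key
    push Not at key
    obtain ⟨g, hg⟩ := key
    have gi : Function.Injective g := (LinearMap.injective_or_eq_zero g).resolve_right hg
    have eg := LinearEquiv.ofInjective g gi
    obtain ⟨q', hq'⟩ := exists_isCompl (LinearMap.range g)
    have e' := Submodule.prodEquivOfIsCompl _ q' hq'
    have := finSub R A q
    have := finSub R A m
    have := finSub R A q'
    have := finSub R A (LinearMap.range g)
    obtain ⟨k, hk⟩ := ih q q' (by
      have h1 : Module.length R M = Module.length R m + Module.length R q := by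
        rw [← Module.length_prod]
        exact (e.restrictScalars R).symm.length_eq
      have := IsSimpleModule.nontrivial A m
      have h2 : 1 ≤ Module.length R m := Order.one_le_iff_pos.2 Module.length_pos
      have h3 : 1 + Module.length R q ≤ 1 + n := by
        calc _ ≤ Module.length R m + Module.length R q := by gcongr
          _ ≤ _ := by rw [← h1]; push_cast at hl; rwa [add_comm]
      exact (ENat.add_le_add_iff_left (by simp)).1 h3) (by
      intro S _ _ _ _
      have h := hS S
      rw [← hh_right R A e, ← hh_right R A e', hh_prod_right, hh_prod_right,
        ← hh_right R A eg] at h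
      omega)
    refine ⟨e'.toLinearMap ∘ₗ (eg.toLinearMap.prodMap k) ∘ₗ e.symm.toLinearMap, ?_⟩
    have hpm : Function.Injective (eg.toLinearMap.prodMap k) := by
      rintro ⟨a, b⟩ ⟨a', b'⟩ h
      simp only [LinearMap.prodMap_apply, Prod.mk.injEq] at h
      rw [eg.injective h.1, hk h.2]
    exact e'.injective.comp (hpm.comp e.symm.injective)

/-- the socle -/
def soc (W : Type u) [AddCommGroup W] [Module A W] : Submodule A W :=
  sSup {m : Submodule A W | IsSimpleModule A m}

instance (W : Type u) [AddCommGroup W] [Module A W] : IsSemisimpleModule A (soc A W) := by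
  unfold soc
  rw [sSup_eq_iSup]
  exact isSemisimpleModule_biSup_of_isSemisimpleModule_submodule
    (fun m (hm : IsSimpleModule A m) => inferInstance)

lemma hh_soc (W S : Type u) [AddCommGroup W] [Module A W] [Module R W] [IsScalarTower R A W]
    [AddCommGroup S] [Module A S] [IsSimpleModule A S] : hh R A S (soc A W) = hh R A S W := by
  unfold hh
  congr 1
  refine LinearEquiv.length_eq (R := R) (LinearEquiv.ofBijective
    { toFun := fun g => (soc A W).subtype ∘ₗ g
      map_add' := fun _ _ => rfl
      map_smul' := fun _ _ => rfl } ⟨?_, ?_⟩)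
  · intro g g' h
    ext x
    exact LinearMap.congr_fun h x
  · intro g
    refine ⟨LinearMap.codRestrict _ g fun x => ?_, rfl⟩
    rcases LinearMap.injective_or_eq_zero g with hg | hg
    · have : IsSimpleModule A (LinearMap.range g) :=
        IsSimpleModule.congr (LinearEquiv.ofInjective g hg).symm
      exact le_sSup (a := LinearMap.range g) (s := {m : Submodule A W | IsSimpleModule A m})
        this ⟨x, rfl⟩
    · rw [hg]; exact zero_mem _

lemma embed_inj (W W' : Type u) [AddCommGroup W] [Module A W] [Module R W] [IsScalarTower R A W]
    [AddCommGroup W'] [Module A W'] [Module R W'] [IsScalarTower R A W']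
    [Module.Finite R W] [Module.Finite R W'] (hW' : Module.Injective A W')
    (h : ∀ (S : Type u) [AddCommGroup S] [Module A S] [Module.Finite A S] [IsSimpleModule A S],
      hh R A S W ≤ hh R A S W') : ∃ g : W →ₗ[A] W', Function.Injective g := by
  have hAr : IsArtinian A W := isArtinian_of_tower R inferInstance
  have h1 : Module.Finite R (soc A W) :=
    Module.Finite.of_injective ((soc A W).subtype.restrictScalars R) (Submodule.subtype_injective _)
  have h2 : Module.Finite R (soc A W') :=
    Module.Finite.of_injective ((soc A W').subtype.restrictScalars R) (Submodule.subtype_injective _)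
  obtain ⟨g, hg⟩ := embed_ss R A (Module.length R (soc A W)).toNat (soc A W) (soc A W')
    (by rw [ENat.natCast_toNat Module.length_ne_top]) (by
      intro S _ _ _ _
      rw [hh_soc, hh_soc]; exact h S)
  obtain ⟨k, hk⟩ := inj_ext hW' (soc A W).subtype (Submodule.subtype_injective _)
    ((soc A W').subtype ∘ₗ g)
  refine ⟨k, ?_⟩
  rw [← LinearMap.ker_eq_bot]
  rcases IsAtomic.eq_bot_or_exists_atom_le (LinearMap.ker k) with h | ⟨m, hm, hle⟩
  · exact h
  · exfalso
    apply hm.1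
    rw [← isSimpleModule_iff_isAtom] at hm
    rw [eq_bot_iff]
    intro x hx
    have hxs : x ∈ soc A W := le_sSup (a := m) (s := {m : Submodule A W | IsSimpleModule A m}) hm hx
    have h3 := hk ⟨x, hxs⟩
    have h4 : k x = 0 := hle hx
    simp only [Submodule.subtype_apply, h4, LinearMap.comp_apply] at h3
    have h5 : g ⟨x, hxs⟩ = 0 := Subtype.ext h3.symm
    have h6 := hg (h5.trans (map_zero g).symm)
    simpa using congrArg Subtype.val h6

lemma inj_iso (W W' : Type u) [AddCommGroup W] [Module A W] [Module R W] [IsScalarTower R A W]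
    [AddCommGroup W'] [Module A W'] [Module R W'] [IsScalarTower R A W']
    [Module.Finite R W] [Module.Finite R W'] (hW : Module.Injective A W)
    (hW' : Module.Injective A W')
    (h : ∀ (S : Type u) [AddCommGroup S] [Module A S] [Module.Finite A S] [IsSimpleModule A S],
      hh R A S W = hh R A S W') : Nonempty (W ≃ₗ[A] W') := by
  obtain ⟨g, hg⟩ := embed_inj R A W W' hW' fun S _ _ _ _ => (h S).le
  obtain ⟨k, hk⟩ := embed_inj R A W' W hW fun S _ _ _ _ => (h S).ge
  have hAr : IsArtinian A W' := isArtinian_of_tower R inferInstance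
  have := IsArtinian.bijective_of_injective_endomorphism (g ∘ₗ k) (hg.comp hk)
  exact ⟨LinearEquiv.ofBijective g ⟨hg, fun y => by
    obtain ⟨x, hx⟩ := this.2 y
    exact ⟨k x, hx⟩⟩⟩

end

section
variable [Module.Finite R A]

lemma ker_split {Q W C P : Type u} [AddCommGroup Q] [Module A Q] [AddCommGroup W] [Module A W]
    [AddCommGroup C] [Module A C] [AddCommGroup P] [Module A P] [Module.Projective A P]
    (π : Q →ₗ[A] W) (hπ : Function.Surjective π) (q : W →ₗ[A] C)
    (e : P ≃ₗ[A] LinearMap.ker q) :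
    Nonempty ((LinearMap.ker π × P) ≃ₗ[A] LinearMap.ker (q ∘ₗ π)) := by
  obtain ⟨σ, hσ⟩ := Module.projective_lifting_property π
    ((LinearMap.ker q).subtype ∘ₗ e.toLinearMap) hπ
  have hσ' : ∀ p, π (σ p) = (e p : W) := fun p => LinearMap.congr_fun hσ p
  let t : (LinearMap.ker π × P) →ₗ[A] LinearMap.ker (q ∘ₗ π) :=
    LinearMap.codRestrict _ ((LinearMap.ker π).subtype.coprod σ) (by
      rintro ⟨a, p⟩
      have h1 : π a = 0 := a.2
      have h2 : q (e p) = 0 := (e p).2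
      simp [h1, h2, hσ'])
  refine ⟨LinearEquiv.ofBijective t ⟨?_, ?_⟩⟩
  · rw [← LinearMap.ker_eq_bot, eq_bot_iff]
    rintro ⟨a, p⟩ h
    have h0 : (a : Q) + σ p = 0 := by
      simpa [t] using congrArg Subtype.val (LinearMap.mem_ker.1 h)
    have h1 : π a = 0 := a.2
    have h2 := congrArg π h0
    rw [map_add, h1, zero_add, hσ', map_zero] at h2
    have h3 : e p = 0 := Subtype.ext h2
    have h4 : p = 0 := by simpa using h3
    subst h4
    simp only [map_zero, add_zero] at h0
    have : a = 0 := Subtype.ext h0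
    simp [this]
  · rintro ⟨x, hx⟩
    have hx' : q (π x) = 0 := hx
    let p := e.symm ⟨π x, hx'⟩
    have hp : π (σ p) = π x := by rw [hσ']; simp [p]
    refine ⟨(⟨x - σ p, by simp [hp]⟩, p), ?_⟩
    apply Subtype.ext
    simp [t]

lemma ker_count [IsNoetherianRing A] {W W' C P P' : Type u} [AddCommGroup W] [Module A W]
    [AddCommGroup W'] [Module A W']
    [AddCommGroup C] [Module A C] [AddCommGroup P] [Module A P] [Module.Projective A P]
    [AddCommGroup P'] [Module A P'] [Module.Projective A P'] [Module.Finite A P]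
    [Module.Finite A P'] [Module.Finite A W]
    (q : W →ₗ[A] C) (hq : Function.Surjective q) (q' : W' →ₗ[A] C) (hq' : Function.Surjective q')
    (e : P ≃ₗ[A] LinearMap.ker q) (e' : P' ≃ₗ[A] LinearMap.ker q') (w : W ≃ₗ[A] W')
    (S : Type u) [AddCommGroup S] [Module A S] [Module R S] [IsScalarTower R A S]
    [Module.Finite R S] : hh R A P S = hh R A P' S := by
  obtain ⟨n, π, hπ⟩ := Module.Finite.exists_fin' A W
  have hπ' : Function.Surjective (w.toLinearMap ∘ₗ π) := w.surjective.comp hπ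
  obtain ⟨k⟩ := ker_split A π hπ q e
  obtain ⟨k'⟩ := ker_split A (w.toLinearMap ∘ₗ π) hπ' q' e'
  obtain ⟨s⟩ := schanuel (q ∘ₗ π) (q' ∘ₗ w.toLinearMap ∘ₗ π) (hq.comp hπ) (hq'.comp hπ')
  have hk : LinearMap.ker (w.toLinearMap ∘ₗ π) = LinearMap.ker π := by
    ext x; simp
  have h1 := hh_left R A (Y := S) s
  rw [hh_prod_left, hh_prod_left, ← hh_left R A k, ← hh_left R A k', hh_prod_left,
    hh_prod_left, hk] at h1
  omega

end

lemma pi_ker {κ : Type} (I0 Y : Type u) [AddCommGroup I0] [Module A I0]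
    [AddCommGroup Y] [Module A Y] (P : κ → Type u) [∀ i, AddCommGroup (P i)]
    [∀ i, Module A (P i)] (g : ∀ i, P i →ₗ[A] I0) (hg : ∀ i, Function.Injective (g i)) :
    ∃ q : ((κ → I0) × Y) →ₗ[A] ((∀ i, I0 ⧸ LinearMap.range (g i)) × Y),
      Function.Surjective q ∧ Nonempty ((∀ i, P i) ≃ₗ[A] LinearMap.ker q) := by
  let q : ((κ → I0) × Y) →ₗ[A] ((∀ i, I0 ⧸ LinearMap.range (g i)) × Y) :=
    (LinearMap.pi fun i => (LinearMap.range (g i)).mkQ ∘ₗ LinearMap.proj i).prodMap LinearMap.id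
  refine ⟨q, ?_, ?_⟩
  · rintro ⟨a, y⟩
    choose b hb using fun i => Submodule.mkQ_surjective _ (a i)
    exact ⟨(b, y), Prod.ext (funext hb) rfl⟩
  · let t : (∀ i, P i) →ₗ[A] LinearMap.ker q :=
      LinearMap.codRestrict _ (LinearMap.prod (LinearMap.pi fun i => g i ∘ₗ LinearMap.proj i) 0) (by
        intro p
        rw [LinearMap.mem_ker]
        refine Prod.ext (funext fun i => ?_) rfl
        exact (Submodule.Quotient.mk_eq_zero _).2 ⟨p i, rfl⟩)
    refine ⟨LinearEquiv.ofBijective t ⟨?_, ?_⟩⟩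
    · intro p p' h
      funext i
      apply hg i
      exact congrFun (congrArg Prod.fst (congrArg Subtype.val h)) i
    · rintro ⟨⟨a, y⟩, h⟩
      have h1 : (∀ i, (LinearMap.range (g i)).mkQ (a i) = 0) ∧ y = 0 := by
        have := LinearMap.mem_ker.1 h
        exact ⟨fun i => congrFun (congrArg Prod.fst this) i, congrArg Prod.snd this⟩
      choose p hp using fun i => (Submodule.Quotient.mk_eq_zero _).1 (h1.1 i)
      refine ⟨p, Subtype.ext (Prod.ext (funext hp) h1.2.symm)⟩

lemma sum_sig {ι : Type} [Fintype ι] (n F : ι → ℕ) :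
    ∑ x : (Σ k : ι, Fin (n k)), F x.1 = ∑ k, n k * F k := by
  rw [Fintype.sum_sigma]; simp

lemma proj_pi {κ : Type} [Fintype κ] (P : κ → Type u) [∀ i, AddCommGroup (P i)]
    [∀ i, Module A (P i)] [∀ i, Module.Projective A (P i)] :
    Module.Projective A (∀ i, P i) := by
  classical
  exact Module.Projective.of_equiv (DFinsupp.linearEquivFunOnFintype (R := A) (M := P))

set_option maxHeartbeats 1600000 in
theorem count [Module.Finite R A] [IsNoetherianRing A] {ι : Type} [Fintype ι] [DecidableEq ι]
    (S P : ι → Type u)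
    [∀ i, AddCommGroup (S i)] [∀ i, Module A (S i)] [∀ i, Module R (S i)]
    [∀ i, IsScalarTower R A (S i)] [∀ i, Module.Finite R (S i)] [∀ i, Module.Finite A (S i)]
    (hcomp : ∀ (T : Type u) [AddCommGroup T] [Module A T] [IsSimpleModule A T],
      ∃ k, Nonempty (T ≃ₗ[A] S k))
    [∀ i, AddCommGroup (P i)] [∀ i, Module A (P i)] [∀ i, Module.Finite A (P i)]
    [∀ i, Module.Projective A (P i)]
    (hPS : ∀ k j, k ≠ j → hh R A (P k) (S j) = 0) (hPP : ∀ k, hh R A (P k) (S k) ≠ 0)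
    (I0 : Type u) [AddCommGroup I0] [Module A I0] [Module R I0] [IsScalarTower R A I0]
    [Module.Finite R I0] (hI0 : Module.Injective A I0)
    (g : ∀ k, P k →ₗ[A] I0) (hg : ∀ k, Function.Injective (g k))
    (hX : ∀ k, Module.Injective A (I0 ⧸ LinearMap.range (g k)))
    (j0 : ι) (h0 : hh R A (S j0) I0 = 0)
    (h0X : ∀ k, hh R A (S j0) (I0 ⧸ LinearMap.range (g k)) = 0) : False := by
  classical
  have finX : ∀ k, Module.Finite R (I0 ⧸ LinearMap.range (g k)) := fun k =>
    Module.Finite.of_surjective ((LinearMap.range (g k)).mkQ.restrictScalars R)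
      (Submodule.mkQ_surjective _)
  let D : Matrix ι ι ℤ := fun k j =>
    (hh R A (S j) I0 : ℤ) - hh R A (S j) (I0 ⧸ LinearMap.range (g k))
  have hdet : D.det = 0 := Matrix.det_eq_zero_of_column_eq_zero j0 fun k => by
    simp only [D, h0, h0X]; simp
  obtain ⟨a, ha, haD⟩ := Matrix.exists_vecMul_eq_zero_iff.2 hdet
  have haD' : ∀ j, ∑ k, a k * ((hh R A (S j) I0 : ℤ) -
      hh R A (S j) (I0 ⧸ LinearMap.range (g k))) = 0 := fun j => by
    simpa [Matrix.vecMul, dotProduct, D] using congrFun haD j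
  let κ := Σ k : ι, Fin (a k).toNat
  let κ' := Σ k : ι, Fin (-a k).toNat
  obtain ⟨q, hq, ⟨e⟩⟩ := pi_ker A I0 (∀ x : κ', I0 ⧸ LinearMap.range (g x.1))
    (fun x : κ => P x.1) (fun x => g x.1) (fun x => hg x.1)
  obtain ⟨q', hq', ⟨e'⟩⟩ := pi_ker A I0 (∀ x : κ, I0 ⧸ LinearMap.range (g x.1))
    (fun x : κ' => P x.1) (fun x => g x.1) (fun x => hg x.1)
  have w : Nonempty (((κ → I0) × (∀ x : κ', I0 ⧸ LinearMap.range (g x.1))) ≃ₗ[A]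
      ((κ' → I0) × (∀ x : κ, I0 ⧸ LinearMap.range (g x.1)))) := by
    refine inj_iso R A _ _ ?_ ?_ ?_
    · refine inj_prod ?_ ?_ <;> infer_instance
    · refine inj_prod ?_ ?_ <;> infer_instance
    · intro T _ _ _ _
      obtain ⟨j, ⟨t⟩⟩ := hcomp T
      rw [hh_left R A t, hh_left R A t, hh_prod_right, hh_prod_right, hh_pi_right, hh_pi_right,
        hh_pi_right, hh_pi_right]
      rw [sum_sig (fun k => (a k).toNat) (fun _ => hh R A (S j) I0),
        sum_sig (fun k => (-a k).toNat) (fun _ => hh R A (S j) I0),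
        sum_sig (fun k => (a k).toNat) (fun k => hh R A (S j) (I0 ⧸ LinearMap.range (g k))),
        sum_sig (fun k => (-a k).toNat) (fun k => hh R A (S j) (I0 ⧸ LinearMap.range (g k)))]
      zify
      have h := haD' j
      rw [← sub_eq_zero, ← h, ← Finset.sum_add_distrib, ← Finset.sum_add_distrib,
        ← Finset.sum_sub_distrib]
      refine Finset.sum_congr rfl fun k _ => ?_
      have hk : a k = ((a k).toNat : ℤ) - ((-a k).toNat : ℤ) := by omega
      generalize ((a k).toNat : ℤ) = u at *
      generalize ((-a k).toNat : ℤ) = v at *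
      rw [hk]; ring
  obtain ⟨w⟩ := w
  have hW : Module.Finite A ((κ → I0) × (∀ x : κ', I0 ⧸ LinearMap.range (g x.1))) :=
    Module.Finite.of_restrictScalars_finite R A _
  let c := LinearEquiv.prodComm A (∀ x : κ', I0 ⧸ LinearMap.range (g x.1))
    (∀ x : κ, I0 ⧸ LinearMap.range (g x.1))
  have hker : LinearMap.ker q' = LinearMap.ker (c.toLinearMap ∘ₗ q') := by
    rw [LinearEquiv.ker_comp]
  have := proj_pi A (fun x : κ => P x.1)
  have := proj_pi A (fun x : κ' => P x.1)
  apply ha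
  funext j
  have h1 := ker_count R A q hq (c.toLinearMap ∘ₗ q') (c.surjective.comp hq') e
    (e'.trans (LinearEquiv.ofEq _ _ hker)) w (S j)
  rw [hh_pi_left, hh_pi_left] at h1
  rw [sum_sig (fun k => (a k).toNat) (fun k => hh R A (P k) (S j)),
    sum_sig (fun k => (-a k).toNat) (fun k => hh R A (P k) (S j))] at h1
  rw [Finset.sum_eq_single j (fun k _ hk => by rw [hPS k j hk, mul_zero]) (by simp),
    Finset.sum_eq_single j (fun k _ hk => by rw [hPS k j hk, mul_zero]) (by simp)] at h1
  have h2 := Nat.eq_of_mul_eq_mul_right (Nat.pos_of_ne_zero (hPP j)) h1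
  simp only [Pi.zero_apply]
  omega

section
variable [IsArtinianRing A]

lemma simples_exist : ∃ (n : ℕ) (S : Fin n → Submodule A (A ⧸ Ring.jacobson A)),
    (∀ k, IsSimpleModule A (S k)) ∧ (∀ k j, k ≠ j → IsEmpty (S k ≃ₗ[A] S j)) ∧
    ∀ (T : Type u) [AddCommGroup T] [Module A T] [IsSimpleModule A T],
      ∃ k, Nonempty (T ≃ₗ[A] S k) := by
  have hArt : IsArtinian A A := ‹IsArtinianRing A›
  have hN : IsNoetherianRing A := inferInstance
  have hss : IsSemisimpleModule A (A ⧸ Ring.jacobson A) :=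
    (IsArtinian.isSemisimpleModule_iff_jacobson A (A ⧸ Ring.jacobson A)).2
      (Module.jacobson_quotient_jacobson A A)
  obtain ⟨n, ⟨e⟩⟩ := Finite.exists_equiv_fin (isotypicComponents A (A ⧸ Ring.jacobson A))
  choose S hS hSc using fun c : isotypicComponents A (A ⧸ Ring.jacobson A) => c.2
  refine ⟨n, fun k => S (e.symm k), fun k => hS _, ?_, ?_⟩
  · intro k j hkj
    refine ⟨fun t => hkj ?_⟩
    have h1 := t.isotypicComponent_eq (M := A ⧸ Ring.jacobson A)
    rw [← hSc, ← hSc] at h1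
    exact e.symm.injective (Subtype.ext h1)
  · intro T _ _ hT
    obtain ⟨I, hI, ⟨t⟩⟩ := isSimpleModule_iff_quot_maximal.1 hT
    have hle : Ring.jacobson A ≤ I := sInf_le hI.out
    let p : (A ⧸ Ring.jacobson A) →ₗ[A] (A ⧸ I) := Submodule.factor hle
    have hp : Function.Surjective p := Submodule.factor_surjective hle
    obtain ⟨m, hm⟩ := exists_isCompl (LinearMap.ker p)
    have e2 : T ≃ₗ[A] m := (t.trans (p.quotKerEquivOfSurjective hp).symm).trans
      (Submodule.quotientEquivOfIsCompl _ m hm)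
    have hms : IsSimpleModule A m := IsSimpleModule.congr e2.symm
    let c : isotypicComponents A (A ⧸ Ring.jacobson A) := ⟨_, m, hms, rfl⟩
    have h1 : m ≤ isotypicComponent A (A ⧸ Ring.jacobson A) (S c) := by
      rw [← hSc c]; exact m.le_isotypicComponent
    have := hS c
    obtain ⟨e3⟩ := isIsotypicOfType_submodule_iff.1
      (IsIsotypicOfType.isotypicComponent A (A ⧸ Ring.jacobson A) (S c)) m h1
    have e4 : S c ≃ₗ[A] S (e.symm (e c)) := LinearEquiv.ofEq _ _ (by rw [e.symm_apply_apply])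
    exact ⟨e c, ⟨e2.trans (e3.trans e4)⟩⟩

lemma density {n : ℕ} (S : Fin n → Type u) [∀ k, AddCommGroup (S k)] [∀ k, Module A (S k)]
    [∀ k, Module R (S k)] [∀ k, IsScalarTower R A (S k)] [∀ k, Module.Finite R (S k)]
    [∀ k, IsSimpleModule A (S k)] (hne : ∀ k j, k ≠ j → IsEmpty (S k ≃ₗ[A] S j)) (k : Fin n) :
    ∃ c : A, (∀ x : S k, c • x = x) ∧ ∀ j, j ≠ k → ∀ x : S j, c • x = 0 := by
  classical
  have hz : ∀ i j, i ≠ j → ∀ g : S i →ₗ[A] S j, g = 0 := by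
    intro i j hij g
    by_contra hg
    exact (hne i j hij).false (LinearEquiv.ofBijective g (LinearMap.bijective_of_ne_zero hg))
  let F : Module.End (Module.End A (∀ i, S i)) (∀ i, S i) :=
    { toFun := fun m => Pi.single k (m k)
      map_add' := fun m m' => by simp [Pi.single_add]
      map_smul' := fun φ m => by
        have h1 : ∀ i j, i ≠ j → ∀ x : S i, φ (Pi.single i x) j = 0 := fun i j hij x =>
          LinearMap.congr_fun (hz i j hij
            (LinearMap.proj j ∘ₗ φ ∘ₗ LinearMap.single A S i)) x
        simp only [Module.End.smul_def, RingHom.id_apply]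
        funext j
        by_cases hj : j = k
        · subst hj
          rw [Pi.single_eq_same]
          conv_lhs => rw [← Finset.univ_sum_single m, map_sum, Finset.sum_apply]
          exact Finset.sum_eq_single j (fun i _ hi => h1 i j hi _) (by simp)
        · rw [Pi.single_eq_of_ne hj, h1 k j (Ne.symm hj)] }
  obtain ⟨s, hs⟩ := (inferInstance : Module.Finite R (∀ i, S i)).fg_top
  obtain ⟨c, hc⟩ := jacobson_density F s
  have key : ∀ m : (∀ i, S i), Pi.single k (m k) = c • m := by
    let L1 : (∀ i, S i) →ₗ[R] (∀ i, S i) := (LinearMap.single R S k) ∘ₗ LinearMap.proj k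
    let L2 : (∀ i, S i) →ₗ[R] (∀ i, S i) :=
      { toFun := fun m => c • m
        map_add' := fun m m' => smul_add _ _ _
        map_smul' := fun r m => smul_comm _ _ _ }
    have : L1 = L2 := LinearMap.ext_on hs fun m hm => hc m hm
    intro m
    exact LinearMap.congr_fun this m
  refine ⟨c, fun x => ?_, fun j hj x => ?_⟩
  · have := congrFun (key (Pi.single k x)) k
    simpa using this.symm
  · have := congrFun (key (Pi.single j x)) j
    simpa [Pi.single_eq_of_ne hj, Pi.single_eq_of_ne hj.symm] using this.symm

lemma idem_exist {n : ℕ} (S : Fin n → Type u) [∀ k, AddCommGroup (S k)] [∀ k, Module A (S k)]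
    [∀ k, Module R (S k)] [∀ k, IsScalarTower R A (S k)] [∀ k, Module.Finite R (S k)]
    [∀ k, IsSimpleModule A (S k)] (hne : ∀ k j, k ≠ j → IsEmpty (S k ≃ₗ[A] S j))
    (hcomp : ∀ (T : Type u) [AddCommGroup T] [Module A T] [IsSimpleModule A T],
      ∃ k, Nonempty (T ≃ₗ[A] S k)) (k : Fin n) :
    ∃ c : A, c * c = c ∧ (∀ x : S k, c • x = x) ∧ ∀ j, j ≠ k → ∀ x : S j, c • x = 0 := by
  obtain ⟨c, h1, h2⟩ := density R A S hne k
  have hJ : c * c - c ∈ Ring.jacobson A := by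
    refine (Submodule.mem_sInf).2 fun I hI => ?_
    have : IsSimpleModule A (A ⧸ I) := isSimpleModule_iff_isCoatom.2 hI
    obtain ⟨j, ⟨e⟩⟩ := hcomp (A ⧸ I)
    have h3 : ∀ x : S j, (c * c - c) • x = 0 := by
      intro x
      rw [sub_smul, mul_smul]
      by_cases hj : j = k
      · subst hj; rw [h1, h1, sub_self]
      · rw [h2 j hj x]; simp
    have h4 : (c * c - c) • (Submodule.Quotient.mk (1 : A) : A ⧸ I) = 0 := by
      apply e.injective
      rw [map_smul, h3, map_zero]
    rw [← Submodule.Quotient.mk_smul, Submodule.Quotient.mk_eq_zero] at h4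
    simpa using h4
  have hker : ∀ x ∈ RingHom.ker (Ideal.Quotient.mk (Ring.jacobson A)), IsNilpotent x := by
    intro x hx
    rw [Ideal.mk_ker] at hx
    obtain ⟨N, hN⟩ := IsSemiprimaryRing.isNilpotent (R := A)
    refine ⟨N, ?_⟩
    have := Ideal.pow_mem_pow hx N
    rw [hN] at this
    simpa using this
  obtain ⟨c', hc', hcc⟩ := exists_isIdempotentElem_eq_of_ker_isNilpotent
    (Ideal.Quotient.mk (Ring.jacobson A)) hker (Ideal.Quotient.mk _ c) ⟨c, rfl⟩ (by
      unfold IsIdempotentElem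
      rw [← map_mul]
      exact Ideal.Quotient.eq.2 hJ)
  have hd : c' - c ∈ Ring.jacobson A := Ideal.Quotient.eq.1 hcc
  have hs : ∀ j (x : S j), c' • x = c • x := by
    intro j x
    have := Module.mem_annihilator.1 (IsSemisimpleModule.jacobson_le_annihilator A (S j) hd) x
    rwa [sub_smul, sub_eq_zero] at this
  exact ⟨c', hc', fun x => by rw [hs, h1], fun j hj x => by rw [hs, h2 j hj]⟩

end

lemma retract_exists {P B I0 : Type u} [AddCommGroup P] [Module A P] [AddCommGroup B] [Module A B]
    [AddCommGroup I0] [Module A I0] (hI : Module.Injective A I0) (f : B →ₗ[A] I0)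
    (hf : Function.Injective f) (i : P →ₗ[A] B) (r : B →ₗ[A] P) (hr : ∀ p, r (i p) = p) :
    ∃ (α : (I0 ⧸ LinearMap.range (f ∘ₗ i)) →ₗ[A] (I0 × (I0 ⧸ LinearMap.range f)))
      (β : (I0 × (I0 ⧸ LinearMap.range f)) →ₗ[A] (I0 ⧸ LinearMap.range (f ∘ₗ i))),
      ∀ x, β (α x) = x := by
  obtain ⟨τ, hτ⟩ := inj_ext hI f hf (f ∘ₗ i ∘ₗ r)
  let α : (I0 ⧸ LinearMap.range (f ∘ₗ i)) →ₗ[A] (I0 × (I0 ⧸ LinearMap.range f)) :=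
    Submodule.liftQ _ (LinearMap.prod (LinearMap.id - τ) (LinearMap.range f).mkQ) (by
      rintro _ ⟨p, rfl⟩
      rw [LinearMap.mem_ker]
      refine Prod.ext ?_ ?_
      · simp [hτ, hr]
      · exact (Submodule.Quotient.mk_eq_zero _).2 ⟨i p, rfl⟩)
  let β : (I0 × (I0 ⧸ LinearMap.range f)) →ₗ[A] (I0 ⧸ LinearMap.range (f ∘ₗ i)) :=
    LinearMap.coprod (LinearMap.range (f ∘ₗ i)).mkQ
      (Submodule.liftQ _ ((LinearMap.range (f ∘ₗ i)).mkQ ∘ₗ τ) (by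
        rintro _ ⟨a, rfl⟩
        rw [LinearMap.mem_ker]
        exact (Submodule.Quotient.mk_eq_zero _).2 ⟨r a, by simp [hτ]⟩))
  refine ⟨α, β, fun x => ?_⟩
  obtain ⟨x, rfl⟩ := Submodule.mkQ_surjective _ x
  simp [α, β]

section
variable [Module.Finite R A]

lemma hull_fin_simple (I0 S : Type u) [AddCommGroup I0] [Module A I0] [Module R I0]
    [IsScalarTower R A I0] (f : A →ₗ[A] I0) (hf : IsInjHull A f)
    [AddCommGroup S] [Module A S] [IsSimpleModule A S] :
    Module.Finite R (S →ₗ[A] I0) := by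
  have := finHom R A S A
  let Φ : (S →ₗ[A] A) →ₗ[R] (S →ₗ[A] I0) :=
    { toFun := fun g => f ∘ₗ g
      map_add' := fun g g' => by ext x; simp
      map_smul' := fun r g => by ext x; exact lin_smul R A f r (g x) }
  refine Module.Finite.of_surjective Φ fun φ => ?_
  have hall : ∀ x, φ x ∈ LinearMap.range f := by
    by_cases h0 : φ = 0
    · intro x; rw [h0]; exact zero_mem _
    have h1 := hf.2.2 (LinearMap.range φ) (fun h => h0 (LinearMap.range_eq_bot.1 h))
    obtain ⟨y, hy, hy0⟩ := Submodule.exists_mem_ne_zero_of_ne_bot h1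
    obtain ⟨⟨x, rfl⟩, hyf⟩ := hy
    have h2 : Submodule.comap φ (LinearMap.range f) = ⊤ := by
      refine (eq_bot_or_eq_top _).resolve_left fun hb => hy0 ?_
      have : x ∈ Submodule.comap φ (LinearMap.range f) := hyf
      rw [hb, Submodule.mem_bot] at this
      rw [this, map_zero]
    intro x
    have : x ∈ Submodule.comap φ (LinearMap.range f) := by rw [h2]; trivial
    exact this
  obtain ⟨h, hh⟩ := corestr f hf.2.1 φ hall
  exact ⟨h, LinearMap.ext hh⟩

lemma hull_fin_hom (I0 : Type u) [AddCommGroup I0] [Module A I0] [Module R I0]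
    [IsScalarTower R A I0] (f : A →ₗ[A] I0) (hf : IsInjHull A f)
    (M : Type u) [AddCommGroup M] [Module A M] (hM : IsFiniteLength A M) :
    IsNoetherian R (M →ₗ[A] I0) := by
  induction hM with
  | of_subsingleton =>
    rename_i M _ _ _
    have : Subsingleton (M →ₗ[A] I0) := ⟨fun a b => by ext x; rw [Subsingleton.elim x 0]; simp⟩
    infer_instance
  | of_simple_quotient h ih =>
    rename_i M _ _ N hs
    have := hull_fin_simple R A I0 (M ⧸ N) f hf
    let Φ : ((M ⧸ N) →ₗ[A] I0) →ₗ[R] (M →ₗ[A] I0) :=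
      { toFun := fun g => g ∘ₗ N.mkQ
        map_add' := fun _ _ => rfl
        map_smul' := fun _ _ => rfl }
    let Ψ : (M →ₗ[A] I0) →ₗ[R] (N →ₗ[A] I0) :=
      { toFun := fun g => g ∘ₗ N.subtype
        map_add' := fun _ _ => rfl
        map_smul' := fun _ _ => rfl }
    refine isNoetherian_of_range_eq_ker Φ Ψ ?_
    ext g
    constructor
    · rintro ⟨g, rfl⟩
      rw [LinearMap.mem_ker]
      ext x
      have : N.mkQ (x : M) = 0 := (Submodule.Quotient.mk_eq_zero _).2 x.2
      change g (N.mkQ x) = 0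
      rw [this, map_zero]
    · intro hg
      have hg' : ∀ x : N, g x = 0 := fun x => LinearMap.congr_fun (LinearMap.mem_ker.1 hg) x
      exact ⟨N.liftQ g fun x hx => hg' ⟨x, hx⟩, Submodule.liftQ_mkQ _ _ _⟩

lemma hull_fin (I0 : Type u) [AddCommGroup I0] [Module A I0] [Module R I0]
    [IsScalarTower R A I0] (f : A →ₗ[A] I0) (hf : IsInjHull A f) : Module.Finite R I0 := by
  have h1 : IsArtinian A A := isArtinian_of_tower R inferInstance
  have h2 : IsNoetherian A A := isNoetherian_of_tower R inferInstance
  have := hull_fin_hom R A I0 f hf A (isFiniteLength_iff_isNoetherian_isArtinian.2 ⟨h2, h1⟩)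
  let E : (A →ₗ[A] I0) →ₗ[R] I0 :=
    { toFun := fun g => g 1
      map_add' := fun _ _ => rfl
      map_smul' := fun _ _ => rfl }
  exact Module.Finite.of_surjective E fun x => ⟨LinearMap.toSpanSingleton A I0 x, by simp [E]⟩

set_option maxHeartbeats 1600000 in
theorem simples_embed (I0 : Type u) [AddCommGroup I0] [Module A I0] [Module R I0]
    [IsScalarTower R A I0] (f : A →ₗ[A] I0) (hf : IsInjHull A f)
    (hI1 : Module.Injective A (I0 ⧸ LinearMap.range f)) (𝔪 : Ideal A) (hm : 𝔪.IsMaximal) :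
    ∃ φ : (A ⧸ 𝔪) →ₗ[A] (I0 × (I0 ⧸ LinearMap.range f)), φ ≠ 0 := by
  by_contra hcon
  push Not at hcon
  have h1 : IsArtinianRing A := isArtinian_of_tower R inferInstance
  have h2 : IsNoetherianRing A := isNoetherian_of_tower R inferInstance
  have h3 := hull_fin R A I0 f hf
  obtain ⟨n, S, hS, hne, hcomp⟩ := simples_exist A
  have finQ : Module.Finite R (A ⧸ Ring.jacobson A) :=
    Module.Finite.of_surjective ((Ring.jacobson A).mkQ.restrictScalars R)
      (Submodule.mkQ_surjective _)
  have finS : ∀ k, Module.Finite R (S k) := fun k => finSub R A (S k)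
  have hsim : IsSimpleModule A (A ⧸ 𝔪) := isSimpleModule_iff_isCoatom.2 hm.out
  obtain ⟨j0, ⟨t⟩⟩ := hcomp (A ⧸ 𝔪)
  have hz : ∀ φ : S j0 →ₗ[A] (I0 × (I0 ⧸ LinearMap.range f)), φ = 0 := by
    intro φ
    have := hcon (φ ∘ₗ t.toLinearMap)
    ext x : 1
    simpa using LinearMap.congr_fun this (t.symm x)
  choose c hcc hc1 hc2 using idem_exist R A (fun k => S k) hne hcomp
  let P : Fin n → Submodule A A := fun k => A ∙ (c k)
  let r : ∀ k, A →ₗ[A] P k := fun k =>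
    LinearMap.codRestrict (P k) (LinearMap.toSpanSingleton A A (c k))
      (fun a => Submodule.mem_span_singleton.2 ⟨a, rfl⟩)
  have hr : ∀ k (p : P k), r k ((P k).subtype p) = p := by
    rintro k ⟨p, hp⟩
    obtain ⟨a, rfl⟩ := Submodule.mem_span_singleton.1 hp
    apply Subtype.ext
    simp [r, mul_assoc, hcc]
  have hproj : ∀ k, Module.Projective A (P k) := fun k =>
    Module.Projective.of_split (P k).subtype (r k) (LinearMap.ext (hr k))
  have hret := fun k => retract_exists A hf.1 f hf.2.1 (P k).subtype (r k) (hr k)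
  refine count R A (fun k => S k) (fun k => P k) hcomp ?_ ?_ I0 hf.1
    (fun k => f ∘ₗ (P k).subtype) (fun k => hf.2.1.comp (Submodule.subtype_injective _)) ?_ j0 ?_ ?_
  · intro k j hkj
    rw [hh_zero_iff]
    intro g
    let ck : P k := ⟨c k, Submodule.mem_span_singleton_self _⟩
    have e1 : c k • ck = ck := Subtype.ext (hcc k)
    have e2 : g ck = 0 := by
      rw [← e1, map_smul]
      exact hc2 k j hkj.symm _
    ext ⟨p, hp⟩ : 1
    obtain ⟨a, rfl⟩ := Submodule.mem_span_singleton.1 hp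
    have e3 : (⟨a • c k, hp⟩ : P k) = a • ck := rfl
    rw [e3, map_smul, e2, smul_zero, LinearMap.zero_apply]
  · intro k
    rw [Ne, hh_zero_iff]
    intro hall
    have := IsSimpleModule.nontrivial A (S k)
    obtain ⟨x, hx⟩ := exists_ne (0 : S k)
    have e1 := LinearMap.congr_fun (hall (LinearMap.toSpanSingleton A (S k) x ∘ₗ (P k).subtype))
      ⟨c k, Submodule.mem_span_singleton_self _⟩
    apply hx
    rw [← hc1 k x]
    exact e1
  · intro k
    obtain ⟨α, β, h⟩ := hret k
    exact inj_retract (inj_prod hf.1 hI1) α β h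
  · rw [hh_zero_iff]
    intro g
    ext x : 1
    exact congrArg Prod.fst (LinearMap.congr_fun (hz (LinearMap.prod g 0)) x)
  · intro k
    have : Module.Finite R (I0 ⧸ LinearMap.range (f ∘ₗ (P k).subtype)) :=
      Module.Finite.of_surjective ((LinearMap.range (f ∘ₗ (P k).subtype)).mkQ.restrictScalars R)
        (Submodule.mkQ_surjective _)
    rw [hh_zero_iff]
    intro g
    obtain ⟨α, β, h⟩ := hret k
    ext x : 1
    have h5 := LinearMap.congr_fun (hz (α ∘ₗ g)) x
    rw [← h (g x)]
    simp only [LinearMap.comp_apply, LinearMap.zero_apply] at h5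
    rw [h5, map_zero, LinearMap.zero_apply]

end

end counting


/-- Let `A` be an artin algebra with `id A ≤ 1` whose minimal injective
coresolution `0 → A → I⁰ → I⁰/A → 0` has terms of projective dimension at most one
(here `I⁰` is the injective hull of `A`). Then `A` is `1`-Iwanaga–Gorenstein:
`id A ≤ 1` and `id Aᵒᵖ ≤ 1`. -/
theorem stmt14 (R₀ : Type u) [CommRing R₀] [IsArtinianRing R₀]
    (A : Type u) [Ring A] [Algebra R₀ A] [Module.Finite R₀ A]
    (hid : injDim A A ≤ (1 : ℕ∞))
    (I0 : Type u) [AddCommGroup I0] [Module A I0]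
    (f : A →ₗ[A] I0) (hf : IsInjHull A f)
    (hpd0 : projDim A I0 ≤ (1 : ℕ∞))
    (hpd1 : projDim A (I0 ⧸ LinearMap.range f) ≤ (1 : ℕ∞)) :
    injDim Aᵐᵒᵖ Aᵐᵒᵖ ≤ (1 : ℕ∞) := by
  letI : Module R₀ I0 := Module.compHom I0 (algebraMap R₀ A)
  haveI : IsScalarTower R₀ A I0 := ⟨fun r a x => by
    rw [Algebra.smul_def, mul_smul]; rfl⟩
  have hI1 : Module.Injective A (I0 ⧸ LinearMap.range f) :=
    inj_quot (injDimLE_of_injDim hid) hf.1 f hf.2.1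
  have hNop : IsNoetherianRing Aᵐᵒᵖ := isNoetherian_of_tower R₀ inferInstance
  exact injDim_of_injDimLE (injDimLE_op (I0 × (I0 ⧸ LinearMap.range f))
    (inj_prod hf.1 hI1) (simples_embed R₀ A I0 f hf hI1)
    ((pd1_of (projDimLE_of_projDim hpd0)).prod (pd1_of (projDimLE_of_projDim hpd1))))
end

section
/- Let A be an artin algebra with both id A < ∞ and id A^op < ∞. Then id A = id A^op. -/
open CategoryTheory TensorProduct

universe u

lemma extZero_iff_s15 (A : Type u) [Ring A] (k : ℕ) (X Y : ModuleCat.{u} A) :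
    ExtZero A (k+1) X Y ↔ Subsingleton (Abelian.Ext.{u} X Y (k+1)) := by
  have P := (HasProjectiveResolution.out (Z := X)).some
  have e := P.isoExt (R := ℤ) (k+1) Y
  have h1 : ExtZero A (k+1) X Y ↔ (P.complex.linearYonedaObj ℤ Y).ExactAt (k+1) := by
    rw [HomologicalComplex.exactAt_iff_isZero_homology, ← e.isZero_iff,
      ModuleCat.isZero_iff_subsingleton]
    rfl
  rw [h1, HomologicalComplex.exactAt_iff' _ k (k+1) (k+2) (by simp) (by simp),
    ShortComplex.moduleCat_exact_iff]
  constructor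
  · intro h
    rw [subsingleton_iff_forall_eq 0]
    intro α
    obtain ⟨f, hf, rfl⟩ := P.extMk_surjective α (k+2) rfl
    rw [P.extMk_eq_zero_iff _ _ _ _ k rfl]
    exact h f hf
  · intro h f hf
    exact (P.extMk_eq_zero_iff f (k+2) rfl hf k rfl).1 (Subsingleton.elim _ _)

lemma injDimLE_iff (A : Type u) [Ring A] (Y : Type u) [AddCommGroup Y] [Module A Y] (n : ℕ) :
    InjDimLE A Y n ↔ HasInjectiveDimensionLE (ModuleCat.of A Y) n := by
  rw [HasInjectiveDimensionLE, hasInjectiveDimensionLT_iff.{u}]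
  constructor
  · intro h i hi X e
    obtain ⟨k, rfl⟩ : ∃ k, i = k + 1 := ⟨i - 1, by lia⟩
    have := (extZero_iff_s15 A k X (ModuleCat.of A Y)).1 (h (k+1) (by lia) X)
    exact Subsingleton.elim _ _
  · intro h k hk X
    obtain ⟨k, rfl⟩ : ∃ j, k = j + 1 := ⟨k - 1, by lia⟩
    refine (extZero_iff_s15 A k X (ModuleCat.of A Y)).2 ?_
    rw [subsingleton_iff_forall_eq 0]
    exact fun α => h (k+1) (by lia) α

open CategoryTheory.Abelian in
lemma injDim_step {C : Type*} [Category.{u} C] [Abelian C] [HasExt.{u} C] [EnoughInjectives C]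
    (m : ℕ) : ∀ (Y : C), HasInjectiveDimensionLT Y (m+2) →
      (∀ I : C, Injective I → Subsingleton (Ext.{u} I Y (m+1))) →
      HasInjectiveDimensionLT Y (m+1) := by
  induction m with
  | zero =>
    intro Y hY h
    let S := ShortComplex.mk _ _ (Limits.cokernel.condition (Injective.ι Y))
    have hS : S.ShortExact :=
      { exact := ShortComplex.exact_of_g_is_cokernel _ (Limits.cokernelIsCokernel S.f) }
    have h2 : Injective S.X₂ := by dsimp [S]; infer_instance
    have h3 : HasInjectiveDimensionLT S.X₃ 1 := (hS.hasInjectiveDimensionLT_X₃_iff 0 h2).2 hY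
    have h3' : Injective S.X₃ := injective_iff_hasInjectiveDimensionLT_one.2 h3
    rw [zero_add, ← injective_iff_hasInjectiveDimensionLT_one,
      injective_iff_subsingleton_ext_one.{u}]
    intro X
    rw [subsingleton_iff_forall_eq 0]
    intro x
    obtain ⟨z, hz⟩ := Ext.covariant_sequence_exact₁ X hS x (Ext.eq_zero_of_injective _) rfl
    have := h S.X₃ h3'
    rw [← hz, show hS.extClass = 0 from Subsingleton.elim _ _, Ext.comp_zero]
  | succ m ih =>
    intro Y hY h
    let S := ShortComplex.mk _ _ (Limits.cokernel.condition (Injective.ι Y))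
    have hS : S.ShortExact :=
      { exact := ShortComplex.exact_of_g_is_cokernel _ (Limits.cokernelIsCokernel S.f) }
    have h2 : Injective S.X₂ := by dsimp [S]; infer_instance
    refine (hS.hasInjectiveDimensionLT_X₃_iff m h2).1 (ih S.X₃ ?_ ?_)
    · exact (hS.hasInjectiveDimensionLT_X₃_iff (m+1) h2).2 hY
    · intro I hI
      rw [subsingleton_iff_forall_eq 0]
      intro x
      have := h I hI
      obtain ⟨z, hz⟩ := Ext.covariant_sequence_exact₃ I hS x rfl (Subsingleton.elim (α := Ext I Y (m+2)) _ _)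
      rw [← hz, Ext.eq_zero_of_injective z, Ext.zero_comp]

open CategoryTheory.Abelian in
lemma injDim_bound {C : Type*} [Category.{u} C] [Abelian C] [HasExt.{u} C] [EnoughInjectives C]
    (n : ℕ) (hn : ∀ I : C, Injective I → HasProjectiveDimensionLE I n) (Y : C) (m : ℕ)
    (hY : HasInjectiveDimensionLE Y m) : HasInjectiveDimensionLE Y n := by
  rcases le_total m n with h | h
  · exact hasInjectiveDimensionLT_of_ge Y (m+1) (n+1) (by lia)
  induction m, h using Nat.le_induction with
  | base => exact hY
  | succ m hm ih =>
    refine ih (injDim_step m Y hY ?_)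
    intro I hI
    have := hn I hI
    exact HasProjectiveDimensionLT.subsingleton I (n+1) (m+1) (by lia) Y

section
variable {A : Type u} [Ring A]

/-- The short exact sequence `ker f → P → X`. -/
def sesKer {P X : Type u} [AddCommGroup P] [Module A P] [AddCommGroup X] [Module A X]
    (f : P →ₗ[A] X) : ShortComplex (ModuleCat.{u} A) :=
  ShortComplex.mk (ModuleCat.ofHom (LinearMap.ker f).subtype) (ModuleCat.ofHom f)
    (by ext x; exact x.2)

lemma sesKer_shortExact {P X : Type u} [AddCommGroup P] [Module A P] [AddCommGroup X] [Module A X]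
    (f : P →ₗ[A] X) (hf : Function.Surjective f) : (sesKer f).ShortExact :=
  ModuleCat.shortComplex_shortExact _ f.exact_subtype_ker_map (Submodule.injective_subtype _) hf

open CategoryTheory.Abelian in
lemma ext_one_iff {P X Y : Type u} [AddCommGroup P] [Module A P] [AddCommGroup X] [Module A X]
    [AddCommGroup Y] [Module A Y] [Module.Projective A P]
    (f : P →ₗ[A] X) (hf : Function.Surjective f) :
    Subsingleton (Ext.{u} (ModuleCat.of A X) (ModuleCat.of A Y) 1) ↔
      ∀ g : LinearMap.ker f →ₗ[A] Y, ∃ h : P →ₗ[A] Y, ∀ x : LinearMap.ker f, h x = g x := by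
  have hS := sesKer_shortExact f hf
  have hP : Projective (sesKer f).X₂ := (IsProjective.iff_projective (R := A) P).1 inferInstance
  constructor
  · intro hs g
    have hs' : Subsingleton (Ext.{u} (sesKer f).X₃ (ModuleCat.of A Y) 1) := hs
    obtain ⟨φ, hφ⟩ := Ext.contravariant_sequence_exact₁ hS (ModuleCat.of A Y)
      (Ext.mk₀ (ModuleCat.ofHom g)) (add_zero 1) (Subsingleton.elim _ _)
    obtain ⟨φ, rfl⟩ := Ext.homEquiv₀.symm.surjective φ
    have h1 : Ext.mk₀ ((sesKer f).f ≫ φ) = Ext.mk₀ (ModuleCat.ofHom g) :=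
      (Ext.mk₀_comp_mk₀ _ _).symm.trans hφ
    have h2 : (sesKer f).f ≫ φ = ModuleCat.ofHom g := Ext.homEquiv₀.symm.injective h1
    exact ⟨φ.hom, fun x => congr($h2 x)⟩
  · intro h
    rw [subsingleton_iff_forall_eq 0]
    intro x
    obtain ⟨z, hz⟩ := Ext.contravariant_sequence_exact₃ hS (ModuleCat.of A Y) x
      (Ext.eq_zero_of_projective _) (add_zero 1)
    obtain ⟨z, rfl⟩ := Ext.homEquiv₀.symm.surjective z
    obtain ⟨w, hw⟩ := h z.hom
    have e : z = (sesKer f).f ≫ ModuleCat.ofHom w := by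
      ext x; exact (hw x).symm
    rw [← hz]
    subst e
    have : Ext.homEquiv₀.symm ((sesKer f).f ≫ ModuleCat.ofHom w) =
        (Ext.mk₀ (sesKer f).f).comp (Ext.mk₀ (ModuleCat.ofHom w)) (zero_add 0) :=
      (Ext.mk₀_comp_mk₀ _ _).symm
    rw [this, ShortComplex.ShortExact.extClass_comp_assoc]
    rfl

open CategoryTheory.Abelian in
lemma injDim_of_fg (n : ℕ) : ∀ (Y : ModuleCat.{u} A)
    (_ : ∀ (X : Type u) [AddCommGroup X] [Module A X] [Module.Finite A X],
      Subsingleton (Ext.{u} (ModuleCat.of A X) Y (n+1))), HasInjectiveDimensionLE Y n := by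
  induction n with
  | zero =>
    intro Y h
    refine injective_iff_hasInjectiveDimensionLT_one.1 ?_
    refine (Module.injective_iff_injective_object A Y).1 (Module.Baer.injective ?_)
    intro I g
    obtain ⟨k, hk⟩ := (ext_one_iff (Y := Y) I.mkQ I.mkQ_surjective).1 (h (A ⧸ I))
      (g ∘ₗ (LinearEquiv.ofEq _ _ I.ker_mkQ).toLinearMap)
    exact ⟨k, fun x hx => hk ⟨x, by simpa using hx⟩⟩
  | succ n ih =>
    intro Y h
    let S := ShortComplex.mk _ _ (Limits.cokernel.condition (Injective.ι Y))
    have hS : S.ShortExact :=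
      { exact := ShortComplex.exact_of_g_is_cokernel _ (Limits.cokernelIsCokernel S.f) }
    have h2 : Injective S.X₂ := by dsimp [S]; infer_instance
    refine (hS.hasInjectiveDimensionLT_X₃_iff n h2).1 (ih S.X₃ ?_)
    intro X _ _ _
    rw [subsingleton_iff_forall_eq 0]
    intro x
    have := h X
    obtain ⟨z, hz⟩ := Ext.covariant_sequence_exact₃ _ hS x rfl
      (Subsingleton.elim (α := Ext (ModuleCat.of A X) Y (n+2)) _ _)
    rw [← hz, Ext.eq_zero_of_injective z, Ext.zero_comp]

open CategoryTheory.Abelian in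
/-- dimension shifting of a comparison of vanishing of `Ext` on finitely generated modules. -/
lemma ext_shift [IsNoetherianRing A] (Y W : ModuleCat.{u} A)
    (h1 : ∀ (X : Type u) [AddCommGroup X] [Module A X] [Module.Finite A X],
      Subsingleton (Ext.{u} (ModuleCat.of A X) Y 1) →
      Subsingleton (Ext.{u} (ModuleCat.of A X) W 1)) (n : ℕ) :
    ∀ (X : Type u) [AddCommGroup X] [Module A X] [Module.Finite A X],
      Subsingleton (Ext.{u} (ModuleCat.of A X) Y (n+1)) →
      Subsingleton (Ext.{u} (ModuleCat.of A X) W (n+1)) := by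
  induction n with
  | zero => exact h1
  | succ n ih =>
    intro X _ _ _ hX
    obtain ⟨r, f, hf⟩ := Module.Finite.exists_fin' A X
    have hS := sesKer_shortExact f hf
    have hP : Projective (sesKer f).X₂ :=
      (IsProjective.iff_projective (R := A) (Fin r → A)).1 inferInstance
    have hK : Subsingleton (Ext.{u} (sesKer f).X₁ W (n+1)) := by
      refine ih (LinearMap.ker f) ?_
      rw [subsingleton_iff_forall_eq 0]
      intro x
      have hX' : Subsingleton (Ext.{u} (sesKer f).X₃ Y (n+2)) := hX
      obtain ⟨z, hz⟩ := Ext.contravariant_sequence_exact₁ hS Y x (add_comm 1 (n+1))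
        (Subsingleton.elim (α := Ext (sesKer f).X₃ Y (n+2)) _ _)
      rw [← hz, Ext.eq_zero_of_projective z, Ext.comp_zero]; rfl
    rw [subsingleton_iff_forall_eq 0]
    intro x
    obtain ⟨z, hz⟩ := Ext.contravariant_sequence_exact₃ hS W x
      (Ext.eq_zero_of_projective _) (add_comm 1 (n+1))
    rw [← hz, Subsingleton.elim z 0, Ext.comp_zero]; rfl
end

/-- A pair of mutually opposite rings. -/
structure OpPair (A B : Type u) [Ring A] [Ring B] where
  s : A →+ B
  t : B →+ A
  s_one : s 1 = 1
  t_one : t 1 = 1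
  s_mul : ∀ x y, s (x * y) = s y * s x
  t_mul : ∀ x y, t (x * y) = t y * t x
  st : ∀ x, s (t x) = x
  ts : ∀ x, t (s x) = x

namespace OpPair

variable {A B : Type u} [Ring A] [Ring B]

/-- The symmetric pair. -/
def symm (p : OpPair A B) : OpPair B A where
  s := p.t
  t := p.s
  s_one := p.t_one
  t_one := p.s_one
  s_mul := p.t_mul
  t_mul := p.s_mul
  st := p.ts
  ts := p.st

/-- The character dual of an `A`-module, as a `B`-module. -/
def Dual (_ : OpPair A B) (M : Type u) [AddCommGroup M] : Type u := M →+ AddCircle (1 : ℚ)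

variable (p : OpPair A B)

instance (M : Type u) [AddCommGroup M] : AddCommGroup (p.Dual M) :=
  inferInstanceAs (AddCommGroup (M →+ AddCircle (1 : ℚ)))

instance (M : Type u) [AddCommGroup M] : FunLike (p.Dual M) M (AddCircle (1 : ℚ)) :=
  inferInstanceAs (FunLike (M →+ AddCircle (1 : ℚ)) M (AddCircle (1 : ℚ)))

instance (M : Type u) [AddCommGroup M] : AddMonoidHomClass (p.Dual M) M (AddCircle (1 : ℚ)) :=
  inferInstanceAs (AddMonoidHomClass (M →+ AddCircle (1 : ℚ)) M (AddCircle (1 : ℚ)))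

section
variable {M : Type u} [AddCommGroup M]

@[ext] lemma dual_ext {f g : p.Dual M} (h : ∀ x, f x = g x) : f = g := DFunLike.ext _ _ h

@[simp] lemma dual_add_apply (f g : p.Dual M) (x : M) : (f + g) x = f x + g x := rfl

@[simp] lemma dual_zero_apply (x : M) : (0 : p.Dual M) x = 0 := rfl

lemma dual_sum_apply {ι : Type*} (s : Finset ι) (f : ι → p.Dual M) (x : M) :
    (∑ i ∈ s, f i) x = ∑ i ∈ s, f i x :=
  map_sum (AddMonoidHom.eval x : (M →+ AddCircle (1 : ℚ)) →+ AddCircle (1 : ℚ)) f s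

variable [Module A M]

instance : SMul B (p.Dual M) where
  smul b f := (AddMonoidHom.comp (show M →+ AddCircle (1 : ℚ) from f)
    (DistribSMul.toAddMonoidHom M (p.t b)))

@[simp] lemma dual_smul_apply (b : B) (f : p.Dual M) (x : M) : (b • f) x = f (p.t b • x) := rfl

instance : Module B (p.Dual M) where
  one_smul f := by ext x; simp [p.t_one]
  mul_smul b c f := by ext x; simp [p.t_mul, mul_smul]
  smul_zero b := by ext x; simp
  smul_add b f g := by ext x; simp
  add_smul b c f := by ext x; simp [add_smul]
  zero_smul f := by ext x; simp

end

variable {M N : Type u} [AddCommGroup M] [Module A M] [AddCommGroup N] [Module A N]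

/-- The dual of a linear map. -/
def dmap (f : M →ₗ[A] N) : p.Dual N →ₗ[B] p.Dual M where
  toFun φ := (show N →+ AddCircle (1 : ℚ) from φ).comp f.toAddMonoidHom
  map_add' _ _ := rfl
  map_smul' b φ := by
    ext x
    exact congrArg φ (f.map_smul (p.t b) x).symm

@[simp] lemma dmap_apply (f : M →ₗ[A] N) (φ : p.Dual N) (x : M) : p.dmap f φ x = φ (f x) := rfl

lemma exists_extension {M N : Type u} [AddCommGroup M] [AddCommGroup N]
    (f : M →+ N) (hf : Function.Injective f) (φ : M →+ AddCircle (1 : ℚ)) :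
    ∃ ψ : N →+ AddCircle (1 : ℚ), ∀ x, ψ (f x) = φ x := by
  obtain ⟨ψ, h⟩ := CharacterModule.dual_surjective_of_injective f.toIntLinearMap hf φ
  exact ⟨ψ, fun x => congr($h x)⟩

/-- Factor a character through a homomorphism. -/
lemma exists_factor {M N : Type u} [AddCommGroup M] [AddCommGroup N]
    (f : M →+ N) (φ : M →+ AddCircle (1 : ℚ)) (h : ∀ x, f x = 0 → φ x = 0) :
    ∃ ψ : N →+ AddCircle (1 : ℚ), ∀ x, ψ (f x) = φ x := by
  obtain ⟨ψ, hψ⟩ := exists_extension (QuotientAddGroup.kerLift f)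
    (QuotientAddGroup.kerLift_injective f) (QuotientAddGroup.lift f.ker φ (fun x hx => h x hx))
  exact ⟨ψ, fun x => hψ (QuotientAddGroup.mk x)⟩

lemma dmap_injective (f : M →ₗ[A] N) (hf : Function.Surjective f) :
    Function.Injective (p.dmap f) := by
  intro φ ψ h
  ext x
  obtain ⟨y, rfl⟩ := hf x
  exact congr($h y)

lemma dmap_surjective (f : M →ₗ[A] N) (hf : Function.Injective f) :
    Function.Surjective (p.dmap f) := by
  intro φ
  obtain ⟨ψ, h⟩ := exists_extension f.toAddMonoidHom hf φ
  exact ⟨ψ, p.dual_ext h⟩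

lemma dmap_exact {L : Type u} [AddCommGroup L] [Module A L] (f : L →ₗ[A] M) (g : M →ₗ[A] N)
    (h : Function.Exact f g) : Function.Exact (p.dmap g) (p.dmap f) := by
  intro φ
  constructor
  · intro hφ
    obtain ⟨ψ, h'⟩ := exists_factor g.toAddMonoidHom φ (fun x hx => by
      obtain ⟨y, rfl⟩ := (h x).1 hx
      exact congr($hφ y))
    exact ⟨ψ, p.dual_ext h'⟩
  · rintro ⟨ψ, rfl⟩
    ext x
    simp [h.apply_apply_eq_zero x]

/-- Adjunction. -/
def adj {N : Type u} [AddCommGroup N] [Module B N] (f : M →ₗ[A] p.symm.Dual N) :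
    N →ₗ[B] p.Dual M where
  toFun n := AddMonoidHom.mk' (fun m => f m n) (fun x y => by simp)
  map_add' x y := by ext m; exact map_add (f m) x y
  map_smul' b x := by
    ext m
    change f m (b • x) = f (p.t b • m) x
    rw [LinearMap.map_smul f, dual_smul_apply]
    change _ = f m (p.s (p.t b) • x)
    rw [p.st]

@[simp] lemma adj_apply {N : Type u} [AddCommGroup N] [Module B N] (f : M →ₗ[A] p.symm.Dual N)
    (n : N) (m : M) : p.adj f n m = f m n := rfl

lemma dual_injective_of_projective (P : Type u) [AddCommGroup P] [Module A P]
    [Module.Projective A P] : Module.Injective B (p.Dual P) where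
  out X Y _ _ _ _ f hf g := by
    obtain ⟨k, hk⟩ := Module.projective_lifting_property (p.symm.dmap f) (p.symm.adj g)
      (p.symm.dmap_surjective f hf)
    refine ⟨p.adj k, fun x => ?_⟩
    ext y
    exact congr($hk y x)

/-- Evaluation into the double dual -/
def ev (M : Type u) [AddCommGroup M] [Module A M] : M →ₗ[A] p.symm.Dual (p.Dual M) :=
  p.symm.adj (M := p.Dual M) (N := M) (LinearMap.id : p.Dual M →ₗ[B] p.Dual M)

lemma ev_injective : Function.Injective (p.ev M) := by
  rw [injective_iff_map_eq_zero]
  intro m hm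
  refine CharacterModule.eq_zero_of_character_apply fun c => ?_
  exact congr($hm (show p.Dual M from c))

lemma semisimple_of_torsion [IsSemiprimaryRing A]
    (h : Module.IsTorsionBySet A M (Ring.jacobson A)) : IsSemisimpleModule A M := by
  let _ := h.module
  exact (h.semilinearMap.isSemisimpleModule_iff_of_bijective Function.bijective_id).2
      inferInstance

lemma extend_torsion [IsSemiprimaryRing A] {L P K : Type u} [AddCommGroup L] [Module A L]
    [AddCommGroup P] [Module A P] [AddCommGroup K] [Module A K]
    (hK : Module.Injective B (p.Dual K)) (h : Module.IsTorsionBySet A M (Ring.jacobson A))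
    (ι : L →ₗ[A] P) (f : P →ₗ[A] K) (hι : Function.Injective ι) (hf : Function.Surjective f)
    (hex : Function.Exact ι f) (g : L →ₗ[A] M) : ∃ h : P →ₗ[A] M, ∀ x, h (ι x) = g x := by
  obtain ⟨r, hr⟩ := hK.out (p.dmap f) (p.dmap_injective f hf) LinearMap.id
  obtain ⟨s, hs⟩ := (((p.dmap_exact ι f hex).split_tfae (p.dmap_injective f hf)
    (p.dmap_surjective ι hι)).out 1 0 rfl rfl).1 ⟨r, LinearMap.ext hr⟩
  let k : P →ₗ[A] p.symm.Dual (p.Dual M) := p.symm.adj (s ∘ₗ p.dmap g)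
  have hk : ∀ x, k (ι x) = p.ev M (g x) := by
    intro x
    ext φ
    exact congr($hs (p.dmap g φ) x)
  have hss : IsSemisimpleModule A (p.symm.Dual (p.Dual M)) := by
    refine semisimple_of_torsion ?_
    rintro Φ ⟨a, ha⟩
    ext φ
    change Φ (p.s a • φ) = 0
    have : p.s a • φ = 0 := by
      ext x
      have hx : a • x = 0 := @h x ⟨a, ha⟩
      rw [dual_smul_apply, p.ts, hx]; simp
    rw [this, map_zero]
  obtain ⟨ρ, hρ⟩ := IsSemisimpleModule.extension_property (p.ev M) p.ev_injective LinearMap.id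
  refine ⟨ρ ∘ₗ k, fun x => ?_⟩
  rw [LinearMap.comp_apply, hk]
  exact congr($hρ (g x))

open CategoryTheory.Abelian in
lemma ext_one_torsion [IsSemiprimaryRing A] (K : Type u) [AddCommGroup K] [Module A K]
    (hK : Module.Injective B (p.Dual K)) (h : Module.IsTorsionBySet A M (Ring.jacobson A)) :
    Subsingleton (Ext.{u} (ModuleCat.of A K) (ModuleCat.of A M) 1) := by
  let f : (K →₀ A) →ₗ[A] K := Finsupp.linearCombination A id
  have hf : Function.Surjective f := Finsupp.linearCombination_id_surjective A K
  rw [ext_one_iff f hf]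
  intro g
  exact p.extend_torsion (L := LinearMap.ker f) hK h (LinearMap.ker f).subtype f (Submodule.injective_subtype _) hf
    f.exact_subtype_ker_map g

open CategoryTheory.Abelian in
/-- If the dual of `K` is injective then `K` is projective, over a semiprimary ring. -/
lemma projective_of_dual_injective [IsSemiprimaryRing A] (K : Type u) [AddCommGroup K] [Module A K]
    (hK : Module.Injective B (p.Dual K)) : Module.Projective A K := by
  rw [IsProjective.iff_projective, projective_iff_subsingleton_ext_one.{u}]
  intro Y
  refine IsSemiprimaryRing.induction ℤ A Y (P := fun (M : Type u) _ _ _ =>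
    Subsingleton (Ext.{u} (ModuleCat.of A K) (ModuleCat.of A M) 1)) ?_ ?_
  · intro M _ _ _ _ _ h
    exact p.ext_one_torsion K hK h
  · intro M _ _ _ _ N h1 h2
    rw [subsingleton_iff_forall_eq 0]
    intro x
    have hS := sesKer_shortExact N.mkQ N.mkQ_surjective
    obtain ⟨z, hz⟩ := Ext.covariant_sequence_exact₂ _ hS x (Subsingleton.elim (h := h2) _ _)
    have e : LinearMap.ker N.mkQ = N := N.ker_mkQ
    have : Subsingleton (Ext.{u} (ModuleCat.of A K) (sesKer N.mkQ).X₁ 1) := by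
      change Subsingleton (Ext.{u} (ModuleCat.of A K) (ModuleCat.of A (LinearMap.ker N.mkQ)) 1)
      rw [e]; exact h1
    rw [← hz, Subsingleton.elim z 0, Ext.zero_comp]
    rfl

end OpPair

namespace OpPair

variable {A B : Type u} [Ring A] [Ring B] (p : OpPair A B)

lemma injDim_dual_shift {L P K : Type u} [AddCommGroup L] [Module A L]
    [AddCommGroup P] [Module A P] [Module.Projective A P] [AddCommGroup K] [Module A K] (n : ℕ)
    (ι : L →ₗ[A] P) (f : P →ₗ[A] K) (hι : Function.Injective ι) (hf : Function.Surjective f)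
    (hex : Function.Exact ι f) (h : HasInjectiveDimensionLE (ModuleCat.of B (p.Dual K)) (n+1)) :
    HasInjectiveDimensionLE (ModuleCat.of B (p.Dual L)) n := by
  have hex' := p.dmap_exact ι f hex
  let T : ShortComplex (ModuleCat.{u} B) := ShortComplex.mk
    (ModuleCat.ofHom (p.dmap f)) (ModuleCat.ofHom (p.dmap ι))
    (by ext1; exact LinearMap.ext fun x => hex'.apply_apply_eq_zero x)
  have hT : T.ShortExact := ModuleCat.shortComplex_shortExact T hex'
    (p.dmap_injective f hf) (p.dmap_surjective ι hι)
  have hI : Injective T.X₂ := (Module.injective_iff_injective_object B (p.Dual P)).1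
    (p.dual_injective_of_projective _)
  exact (hT.hasInjectiveDimensionLT_X₃_iff n hI).2 h

lemma projDim_of_dual [IsSemiprimaryRing A] (n : ℕ) :
    ∀ (I : Type u) [AddCommGroup I] [Module A I],
      HasInjectiveDimensionLE (ModuleCat.of B (p.Dual I)) n →
      HasProjectiveDimensionLE (ModuleCat.of A I) n := by
  induction n with
  | zero =>
    intro I _ _ h
    refine projective_iff_hasProjectiveDimensionLT_one.1 ?_
    refine (IsProjective.iff_projective (R := A) I).1 ?_
    refine p.projective_of_dual_injective I ?_
    exact (Module.injective_iff_injective_object B (p.Dual I)).2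
      (injective_iff_hasInjectiveDimensionLT_one.2 h)
  | succ n ih =>
    intro I _ _ h
    let f : (I →₀ A) →ₗ[A] I := Finsupp.linearCombination A id
    have hf : Function.Surjective f := Finsupp.linearCombination_id_surjective A I
    have hS := sesKer_shortExact f hf
    have hP : Projective (sesKer f).X₂ :=
      (IsProjective.iff_projective (R := A) (I →₀ A)).1 inferInstance
    refine (hS.hasProjectiveDimensionLT_X₃_iff n hP).2 (ih (LinearMap.ker f) ?_)
    exact p.injDim_dual_shift (L := LinearMap.ker f) n (LinearMap.ker f).subtype f (Submodule.injective_subtype _) hf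
      f.exact_subtype_ker_map h

/-- Solvability of linear systems in the dual of an injective module. -/
lemma key_matrix {r s t : ℕ} (ω : Fin s → Fin r → A) (c : Fin t → Fin s → A)
    (hsolve : ∀ a : Fin s → A, (∀ l, ∑ j, c l j * a j = 0) →
      ∃ b : Fin r → A, ∀ j, a j = ∑ k, ω j k * b k)
    (I : Type u) [AddCommGroup I] [Module B I] (hI : Module.Injective B I)
    (w : Fin s → p.symm.Dual I) (hw : ∀ l, ∑ j, c l j • w j = 0) :
    ∃ v : Fin r → p.symm.Dual I, ∀ j, ∑ k, ω j k • v k = w j := by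
  let T : (Fin s → I) →+ (Fin r → I) :=
    AddMonoidHom.mk' (fun i k => ∑ j, p.s (ω j k) • i j) (fun x y => by
      ext k; simp [Finset.sum_add_distrib])
  let Φ : (Fin s → I) →+ AddCircle (1 : ℚ) :=
    AddMonoidHom.mk' (fun i => ∑ j, w j (i j)) (fun x y => by
      simp [Finset.sum_add_distrib])
  obtain ⟨ψ, hψ⟩ := exists_factor T Φ (by
    intro i hi
    let h : (Fin s → B) →ₗ[B] I := ∑ j, (LinearMap.proj j : (Fin s → B) →ₗ[B] B).smulRight (i j)
    have hh : ∀ β, h β = ∑ j, β j • i j := fun β => by simp [h]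
    let C : (Fin s → B) →ₗ[B] (Fin t → B) := LinearMap.pi fun l =>
      ∑ j, (LinearMap.proj j : (Fin s → B) →ₗ[B] B).smulRight (p.s (c l j))
    have hC : ∀ β l, C β l = ∑ j, β j * p.s (c l j) := fun β l => by simp [C]
    have hker : LinearMap.ker C ≤ LinearMap.ker h := by
      intro β hβ
      obtain ⟨b, hb⟩ := hsolve (fun j => p.t (β j)) (fun l => by
        have h0 : p.t (C β l) = 0 := by
          rw [show C β = 0 from hβ]; simp
        rw [hC, map_sum] at h0
        simpa [p.t_mul, p.ts] using h0)
      rw [LinearMap.mem_ker, hh]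
      have hβ' : ∀ j, β j = ∑ k, p.s (b k) * p.s (ω j k) := fun j => by
        rw [← p.st (β j), hb j, map_sum]
        simp [p.s_mul]
      have hT : ∀ k, ∑ j, p.s (ω j k) • i j = 0 := fun k => congr($hi k)
      calc ∑ j, β j • i j = ∑ j, ∑ k, p.s (b k) • p.s (ω j k) • i j := by
            refine Finset.sum_congr rfl fun j _ => ?_
            rw [hβ', Finset.sum_smul]
            simp [mul_smul]
        _ = ∑ k, p.s (b k) • ∑ j, p.s (ω j k) • i j := by
            rw [Finset.sum_comm]
            simp [Finset.smul_sum]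
        _ = 0 := by simp [hT]
    obtain ⟨y, hy⟩ := hI.out ((LinearMap.ker C).liftQ C le_rfl)
      (LinearMap.ker_eq_bot.1 (Submodule.ker_liftQ_eq_bot _ _ _ le_rfl))
      ((LinearMap.ker C).liftQ h hker)
    have hy' : ∀ β, y (C β) = h β := fun β => hy (Submodule.Quotient.mk β)
    let e : Fin t → I := fun l => y (Pi.single l 1)
    have he : ∀ γ, y γ = ∑ l, γ l • e l := fun γ => by
      conv_lhs => rw [← Finset.univ_sum_single γ]
      rw [map_sum]
      refine Finset.sum_congr rfl fun l _ => ?_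
      rw [← map_smul, ← Pi.single_smul]
      simp
    have hi' : ∀ j, i j = ∑ l, p.s (c l j) • e l := fun j => by
      have h1 := hy' (Pi.single j 1)
      rw [hh, he] at h1
      simp only [hC] at h1
      simpa [Pi.single_apply, Finset.sum_ite_eq] using h1.symm
    change ∑ j, w j (i j) = 0
    calc ∑ j, w j (i j) = ∑ j, ∑ l, (c l j • w j) (e l) := by
          refine Finset.sum_congr rfl fun j _ => ?_
          rw [hi', map_sum]; rfl
      _ = ∑ l, (∑ j, c l j • w j) (e l) := by
          rw [Finset.sum_comm]
          simp [dual_sum_apply]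
      _ = 0 := by simp [hw])
  refine ⟨fun k => (ψ.comp (AddMonoidHom.single (fun _ => I) k)), fun j => ?_⟩
  ext x
  rw [dual_sum_apply]
  have h1 := hψ (Pi.single j x)
  have h2 : Φ (Pi.single j x) = w j x := by
    change ∑ j', w j' ((Pi.single j x : Fin s → I) j') = _
    rw [Finset.sum_eq_single j] <;> simp +contextual
  have h3 : T (Pi.single j x) = ∑ k, Pi.single k (p.s (ω j k) • x) := by
    ext k
    change ∑ j', p.s (ω j' k) • ((Pi.single j x : Fin s → I) j') = _
    rw [Finset.sum_apply, Finset.sum_eq_single j, Finset.sum_eq_single k] <;>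
      simp +contextual [eq_comm]
  rw [← h2, ← h1, h3, map_sum]
  rfl

open CategoryTheory.Abelian in
lemma key_ext [IsNoetherianRing A] (I : Type u) [AddCommGroup I] [Module B I]
    (hI : Module.Injective B I) (X : Type u) [AddCommGroup X] [Module A X] [Module.Finite A X]
    (hX : Subsingleton (Ext.{u} (ModuleCat.of A X) (ModuleCat.of A A) 1)) :
    Subsingleton (Ext.{u} (ModuleCat.of A X) (ModuleCat.of A (p.symm.Dual I)) 1) := by
  obtain ⟨r, f, hf⟩ := Module.Finite.exists_fin' A X
  rw [ext_one_iff f hf] at hX ⊢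
  obtain ⟨s, π, hπ⟩ := Module.Finite.exists_fin' A (LinearMap.ker f)
  obtain ⟨t, ρ, hρ⟩ := Module.Finite.exists_fin' A (LinearMap.ker π)
  have sum_repr : ∀ {q : ℕ} {Z : Type u} [AddCommGroup Z] [Module A Z] (g : (Fin q → A) →ₗ[A] Z)
      (z : Fin q → A), g z = ∑ l, z l • g (Pi.single l 1) := by
    intro q Z _ _ g z
    conv_lhs => rw [← Finset.univ_sum_single z]
    rw [map_sum]
    refine Finset.sum_congr rfl fun l _ => ?_
    rw [← map_smul, ← Pi.single_smul]
    simp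
  let ω : Fin s → Fin r → A := fun j => (π (Pi.single j 1)).1
  let c : Fin t → Fin s → A := fun l => (ρ (Pi.single l 1)).1
  -- a tuple killed by the relations defines a map on the kernel
  have lift : ∀ {Z : Type u} [AddCommGroup Z] [Module A Z] (a : Fin s → Z),
      (∀ l, ∑ j, c l j • a j = 0) → ∃ g : LinearMap.ker f →ₗ[A] Z,
        ∀ j, g (π (Pi.single j 1)) = a j := by
    intro Z _ _ a ha
    let g0 : (Fin s → A) →ₗ[A] Z := Fintype.linearCombination A a
    have hg0 : LinearMap.ker π ≤ LinearMap.ker g0 := by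
      intro z hz
      obtain ⟨y, hy⟩ := hρ ⟨z, hz⟩
      have h1 : g0 ∘ₗ (LinearMap.ker π).subtype ∘ₗ ρ = 0 := by
        ext1 l
        ext
        exact ha l
      have h2 : g0 (ρ y).1 = 0 := congr($h1 y)
      rw [hy] at h2
      exact h2
    refine ⟨((LinearMap.ker π).liftQ g0 hg0) ∘ₗ
      (π.quotKerEquivOfSurjective hπ).symm.toLinearMap, fun j => ?_⟩
    have : (π.quotKerEquivOfSurjective hπ).symm (π (Pi.single j 1)) =
        Submodule.Quotient.mk (Pi.single j 1) := by
      rw [LinearEquiv.symm_apply_eq]; rfl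
    rw [LinearMap.comp_apply, LinearEquiv.coe_coe, this]
    change g0 (Pi.single j 1) = _
    simp [g0]
  intro g
  obtain ⟨v, hv⟩ := p.key_matrix ω c (by
    intro a ha
    obtain ⟨g', hg'⟩ := lift a ha
    obtain ⟨h, hh⟩ := hX g'
    refine ⟨fun k => h (Pi.single k 1), fun j => ?_⟩
    rw [← hg', ← hh, sum_repr h]
    rfl) I hI (fun j => g (π (Pi.single j 1))) (by
    intro l
    refine (sum_repr (g ∘ₗ π) (c l)).symm.trans ?_
    have : π (c l) = 0 := (ρ (Pi.single l 1)).2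
    rw [LinearMap.comp_apply, this, map_zero])
  refine ⟨Fintype.linearCombination A v, fun x => ?_⟩
  obtain ⟨y, rfl⟩ := hπ x
  have : Fintype.linearCombination A v ∘ₗ (LinearMap.ker f).subtype ∘ₗ π = g ∘ₗ π := by
    ext1 j
    ext1
    exact hv j
  exact congr($this y)

lemma main (p : OpPair A B) [IsNoetherianRing A] [IsSemiprimaryRing B] (n m : ℕ)
    (hA : InjDimLE A A n) (hB : InjDimLE B B m) : InjDimLE B B n := by
  rw [injDimLE_iff] at hA hB ⊢
  refine injDim_bound n (fun I hI => ?_) _ m hB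
  have hI' : Module.Injective B I := (Module.injective_iff_injective_object B I).2 hI
  refine p.symm.projDim_of_dual n I (injDim_of_fg n _ ?_)
  intro X _ _ _
  refine ext_shift (ModuleCat.of A A) _ (fun X _ _ _ hX => p.key_ext I hI' X hX) n X ?_
  exact HasInjectiveDimensionLT.subsingleton _ (n+1) (n+1) le_rfl _

/-- The pair consisting of a ring and its opposite. -/
def ofRing (A : Type u) [Ring A] : OpPair A Aᵐᵒᵖ where
  s := MulOpposite.opAddEquiv.toAddMonoidHom
  t := MulOpposite.opAddEquiv.symm.toAddMonoidHom
  s_one := rfl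
  t_one := rfl
  s_mul _ _ := rfl
  t_mul _ _ := rfl
  st _ := rfl
  ts _ := rfl

end OpPair

lemma exists_injDimLE (A : Type u) [Ring A] (Y : Type u) [AddCommGroup Y] [Module A Y]
    (h : injDim A Y ≠ ⊤) : ∃ n, InjDimLE A Y n := by
  by_contra! hn
  apply h
  have : {n : ℕ | InjDimLE A Y n} = ∅ := Set.eq_empty_iff_forall_notMem.2 hn
  simp [injDim, this]

/-- Let `A` be an artin algebra with both `id A < ∞` and `id Aᵒᵖ < ∞`.
Then `id A = id Aᵒᵖ`. -/
theorem stmt15 (R₀ : Type u) [CommRing R₀] [IsArtinianRing R₀]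
    (A : Type u) [Ring A] [Algebra R₀ A] [Module.Finite R₀ A]
    (h₁ : injDim A A ≠ ⊤) (h₂ : injDim Aᵐᵒᵖ Aᵐᵒᵖ ≠ ⊤) :
    injDim A A = injDim Aᵐᵒᵖ Aᵐᵒᵖ := by
  have hf : Module.Finite R₀ Aᵐᵒᵖ := Module.Finite.equiv (MulOpposite.opLinearEquiv R₀)
  have a1 : IsArtinianRing A := IsArtinianRing.of_finite R₀ A
  have a2 : IsArtinianRing Aᵐᵒᵖ := IsArtinianRing.of_finite R₀ Aᵐᵒᵖ
  have n1 : IsNoetherianRing A := IsNoetherianRing.of_finite R₀ A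
  have n2 : IsNoetherianRing Aᵐᵒᵖ := IsNoetherianRing.of_finite R₀ Aᵐᵒᵖ
  obtain ⟨m₁, hm₁⟩ := exists_injDimLE A A h₁
  obtain ⟨m₂, hm₂⟩ := exists_injDimLE Aᵐᵒᵖ Aᵐᵒᵖ h₂
  have : {n : ℕ | InjDimLE A A n} = {n : ℕ | InjDimLE Aᵐᵒᵖ Aᵐᵒᵖ n} := by
    ext n
    exact ⟨fun h => (OpPair.ofRing A).main n m₂ h hm₂,
      fun h => (OpPair.ofRing A).symm.main n m₁ h hm₁⟩
  rw [injDim, injDim, this]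
end
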